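/- Let π : (X, σ_X) → (Y, σ_Y) be a factor map between subshifts, Φ = {φ_n}_{n=1}^∞ a subadditive potential on (Y, σ_Y), and F(y) = P(σ_X, π, 0)(y). If M_Φ(Y, σ_Y) consists of exactly one measure, then M_{−F∘π+Φ∘π}(X, σ_X) is weak*-compact. -/

import Mathlib

set_option linter.unusedSectionVars false
set_option linter.unusedVariables false
set_option maxHeartbeats 1000000

open MeasureTheory Filter Topology Set
open scoped ENNReal NNReal Classical

namespace Paper

/-- The shift map on the full sequence space over the alphabet `A`. -/
def shiftF (A : Type*) : (ℕ → A) → (ℕ → A) := fun x i => x (i + 1)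

/-- A (one-sided) subshift over the alphabet `A`: a closed shift-invariant set of sequences. -/
structure Subshift (A : Type*) [TopologicalSpace A] : Type _ where
  carrier : Set (ℕ → A)
  isClosed : IsClosed carrier
  shift_mem : ∀ x ∈ carrier, shiftF A x ∈ carrier

section Defs

variable {A B : Type*}
  [Fintype A] [TopologicalSpace A] [DiscreteTopology A]
  [MeasurableSpace A] [MeasurableSingletonClass A]
  [Fintype B] [TopologicalSpace B] [DiscreteTopology B]
  [MeasurableSpace B] [MeasurableSingletonClass B]

/-- The points of a subshift, as a subtype of the full sequence space. -/
abbrev Subshift.pt (X : Subshift A) : Type _ := ↥X.carrier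

/-- The shift map of a subshift. -/
def Subshift.σ (X : Subshift A) : X.pt → X.pt :=
  fun x => ⟨shiftF A x.1, X.shift_mem x.1 x.2⟩

/-- `M(X, σ_X)`: the set of shift-invariant Borel probability measures on the subshift. -/
def invP (X : Subshift A) : Set (ProbabilityMeasure X.pt) :=
  {μ | μ.toMeasure.map X.σ = μ.toMeasure}

/-- The cylinder set `[w₁ ⋯ wₙ]` of a word, inside the subshift. -/
def cyl (X : Subshift A) {n : ℕ} (w : Fin n → A) : Set X.pt :=
  {x | ∀ i : Fin n, x.1 (i : ℕ) = w i}

/-- The entropy of the partition of `X` into cylinders of length `n` w.r.t. `μ`. -/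
noncomputable def blockH (X : Subshift A) (μ : ProbabilityMeasure X.pt) (n : ℕ) : ℝ :=
  ∑ w : Fin n → A, Real.negMulLog ((μ.toMeasure (cyl X w)).toReal)

/-- The Kolmogorov–Sinai entropy `h_μ(σ_X)` of an invariant measure on a subshift: for
invariant measures the sequence `blockH` is subadditive, so the infimum below is the
usual limit `lim (1/n) H_n` over the generating sequence of cylinder partitions. -/
noncomputable def KS (X : Subshift A) (μ : ProbabilityMeasure X.pt) : ℝ :=
  ⨅ n : ℕ, blockH X μ (n + 1) / (n + 1)

/-- A one-block factor map between subshifts, given by a map on symbols. -/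
structure Factor (X : Subshift A) (Y : Subshift B) where
  symb : A → B
  mem : ∀ x ∈ X.carrier, (fun i => symb (x i)) ∈ Y.carrier
  surj : ∀ y ∈ Y.carrier, ∃ x ∈ X.carrier, (fun i => symb (x i)) = y

variable {X : Subshift A} {Y : Subshift B}

/-- The factor map `π : X → Y` induced by the one-block map on symbols. -/
def Factor.map (π : Factor X Y) : X.pt → Y.pt :=
  fun x => ⟨fun i => π.symb (x.1 i), π.mem x.1 x.2⟩

lemma Factor.measurable_map (π : Factor X Y) : Measurable π.map := by
  apply Measurable.subtype_mk
  apply measurable_pi_lambda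
  intro i
  exact (measurable_of_countable π.symb).comp
    ((measurable_pi_apply i).comp measurable_subtype_coe)

/-- Push-forward `π μ` of a probability measure under the factor map. -/
noncomputable def Factor.push (π : Factor X Y) (μ : ProbabilityMeasure X.pt) :
    ProbabilityMeasure Y.pt :=
  μ.map π.measurable_map.aemeasurable

/-- A word is allowable in `X` if it occurs (initially) in some point of `X`. -/
def allowW (X : Subshift A) {n : ℕ} (w : Fin n → A) : Prop :=
  ∃ x ∈ X.carrier, ∀ i : Fin n, x (i : ℕ) = w i

/-- `|π⁻¹[v₁⋯vₙ]|`: the number of allowable `n`-words of `X` mapped by the one-block map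
to the word `v`. -/
noncomputable def preCnt (π : Factor X Y) {n : ℕ} (v : Fin n → B) : ℕ :=
  Nat.card {w : Fin n → A // allowW X w ∧ ∀ i, π.symb (w i) = v i}

/-- `|D_n(y)|`: the number of length-`n` cylinders of `X` meeting the fiber `π⁻¹(y)`. -/
noncomputable def Dcnt (π : Factor X Y) (n : ℕ) (y : Y.pt) : ℕ :=
  Nat.card {w : Fin n → A // ∃ x : X.pt, π.map x = y ∧ ∀ i : Fin n, x.1 (i : ℕ) = w i}

/-- The relative pressure function `P(σ_X, π, 0)(y) = limsup (1/n) log |D_n(y)|`. -/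
noncomputable def relP (π : Factor X Y) (y : Y.pt) : ℝ :=
  Filter.limsup (fun n : ℕ => Real.log (Dcnt π n y) / n) Filter.atTop

/-- The function `y ↦ limsup (1/n) log |π⁻¹[y₁⋯yₙ]|`. -/
noncomputable def relP' (π : Factor X Y) (y : Y.pt) : ℝ :=
  Filter.limsup (fun n : ℕ => Real.log (preCnt π (fun i : Fin n => y.1 (i : ℕ))) / n)
    Filter.atTop

/-- `h_μ(σ) + ∫ f dμ`, as an extended real number. -/
noncomputable def wtF (X : Subshift A) (f : X.pt → ℝ) (μ : ProbabilityMeasure X.pt) : EReal :=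
  (KS X μ : EReal) + ((∫ x, f x ∂μ.toMeasure : ℝ) : EReal)

/-- `lim (1/n) ∫ φ_n dμ` for a subadditive sequence `Φ`; for invariant `μ` the limit exists
in `[-∞, ∞)` and equals the infimum below, by subadditivity. -/
noncomputable def potLim (X : Subshift A) (Φ : ℕ → X.pt → ℝ)
    (μ : ProbabilityMeasure X.pt) : EReal :=
  ⨅ n : ℕ, (((∫ x, Φ (n + 1) x ∂μ.toMeasure) / (n + 1) : ℝ) : EReal)

/-- `h_μ(σ) + ∫ f dμ + lim (1/n) ∫ φ_n dμ`. -/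
noncomputable def wtFP (X : Subshift A) (f : X.pt → ℝ) (Φ : ℕ → X.pt → ℝ)
    (μ : ProbabilityMeasure X.pt) : EReal :=
  wtF X f μ + potLim X Φ μ

/-- `h_μ(σ) + lim (1/n) ∫ φ_n dμ`. -/
noncomputable def wtP (X : Subshift A) (Φ : ℕ → X.pt → ℝ)
    (μ : ProbabilityMeasure X.pt) : EReal :=
  (KS X μ : EReal) + potLim X Φ μ

/-- `h_μ(σ) - lim (1/n) ∫ φ_n dμ`: the weight of the superadditive potential `-Φ`,
for `Φ` subadditive. -/
noncomputable def wtN (X : Subshift A) (Φ : ℕ → X.pt → ℝ)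
    (μ : ProbabilityMeasure X.pt) : EReal :=
  (KS X μ : EReal) - potLim X Φ μ

/-- `M_f(X, σ_X)`: equilibrium states of a bounded Borel measurable function `f`. -/
def eqF (X : Subshift A) (f : X.pt → ℝ) : Set (ProbabilityMeasure X.pt) :=
  {μ | μ ∈ invP X ∧ wtF X f μ = sSup (wtF X f '' invP X)}

/-- `M_{f+Φ}(X, σ_X)`: equilibrium states of `f + Φ`, `Φ` a subadditive potential. -/
def eqFP (X : Subshift A) (f : X.pt → ℝ) (Φ : ℕ → X.pt → ℝ) :
    Set (ProbabilityMeasure X.pt) :=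
  {μ | μ ∈ invP X ∧ wtFP X f Φ μ = sSup (wtFP X f Φ '' invP X)}

/-- `M_Φ(X, σ_X)`: equilibrium states of a subadditive potential `Φ`. -/
def eqP (X : Subshift A) (Φ : ℕ → X.pt → ℝ) : Set (ProbabilityMeasure X.pt) :=
  {μ | μ ∈ invP X ∧ wtP X Φ μ = sSup (wtP X Φ '' invP X)}

/-- `M_{-Φ}(X, σ_X)`: equilibrium states of `-Φ`, for `Φ` a subadditive potential. -/
def eqN (X : Subshift A) (Φ : ℕ → X.pt → ℝ) : Set (ProbabilityMeasure X.pt) :=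
  {μ | μ ∈ invP X ∧ wtN X Φ μ = sSup (wtN X Φ '' invP X)}

/-- `μ` is a measure of maximal relative entropy over `m`. -/
def maxRelOver (π : Factor X Y) (m : ProbabilityMeasure Y.pt)
    (μ : ProbabilityMeasure X.pt) : Prop :=
  μ ∈ invP X ∧ π.push μ = m ∧
    KS X μ = sSup (KS X '' {ν | ν ∈ invP X ∧ π.push ν = m})

/-- A subadditive potential: a sequence of continuous functions satisfying the
subadditivity condition (`Φ n` is the paper's `φ_n` for `n ≥ 1`). -/
def SubAdd (X : Subshift A) (Φ : ℕ → X.pt → ℝ) : Prop :=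
  (∀ n : ℕ, 0 < n → Continuous (Φ n)) ∧
  ∀ n m : ℕ, 0 < n → 0 < m → ∀ x : X.pt, Φ (n + m) x ≤ Φ n x + Φ m (X.σ^[n] x)

/-- An almost additive potential. -/
def AlmostAdd (X : Subshift A) (Φ : ℕ → X.pt → ℝ) : Prop :=
  (∀ n : ℕ, 0 < n → Continuous (Φ n)) ∧
  ∃ C : ℝ, 0 < C ∧ ∀ n m : ℕ, 0 < n → 0 < m → ∀ x : X.pt,
    -C + Φ n x + Φ m (X.σ^[n] x) ≤ Φ (n + m) x ∧
    Φ (n + m) x ≤ C + Φ n x + Φ m (X.σ^[n] x)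

/-- The metric on the sequence space: `d(x,y) = (1/2)^k` where `k` is the first index at
which `x` and `y` differ, and `d(x,y) = 0` if `x = y`. -/
noncomputable def dSeq (x y : ℕ → A) : ℝ :=
  if x = y then 0 else (1 / 2 : ℝ) ^ sInf {n : ℕ | x n ≠ y n}

/-- An `(n, ε)`-separated (finite) subset of the subshift. -/
def SepSet (Y : Subshift B) (n : ℕ) (ε : ℝ) (E : Finset Y.pt) : Prop :=
  ∀ x ∈ E, ∀ y ∈ E, x ≠ y → ∃ i < n, ε < dSeq ((Y.σ^[i] x) : Y.pt).1 ((Y.σ^[i] y) : Y.pt).1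

/-- `P_n(σ_Y, Φ, ε)`: the supremum of `∑_{y ∈ E} exp (φ_n y)` over `(n,ε)`-separated
sets `E`. -/
noncomputable def PnV (Y : Subshift B) (Φ : ℕ → Y.pt → ℝ) (n : ℕ) (ε : ℝ) : ℝ :=
  sSup {r : ℝ | ∃ E : Finset Y.pt, SepSet Y n ε E ∧ r = ∑ y ∈ E, Real.exp (Φ n y)}

/-- The subadditive topological pressure `P(σ_Y, Φ) = lim_{ε→0} limsup (1/n) log P_n(σ,Φ,ε)`;
since the inner quantity is monotone as `ε` decreases, the limit as `ε → 0⁺` is the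
supremum over `ε > 0`. -/
noncomputable def Press (Y : Subshift B) (Φ : ℕ → Y.pt → ℝ) : EReal :=
  ⨆ (ε : ℝ) (_ : 0 < ε),
    Filter.limsup (fun n : ℕ => ((Real.log (PnV Y Φ n ε) / n : ℝ) : EReal)) Filter.atTop

/-- `X` is a shift of finite type (a 1-step topological Markov shift). -/
def IsSFT (X : Subshift A) : Prop :=
  ∃ Tr : A → A → Prop, X.carrier = {x | ∀ i : ℕ, Tr (x i) (x (i + 1))}

/-- `X` is irreducible: any two allowable words can be joined by some connecting word. -/
def Irr (X : Subshift A) : Prop :=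
  ∀ (m n : ℕ) (u : Fin m → A) (v : Fin n → A), allowW X u → allowW X v →
    ∃ (k : ℕ) (w : Fin k → A), allowW X (Fin.append (Fin.append u w) v)

/-- `X` is topologically mixing: any two allowable words can be joined by connecting words
of all sufficiently large lengths. -/
def Mix (X : Subshift A) : Prop :=
  ∀ (m n : ℕ) (u : Fin m → A) (v : Fin n → A), allowW X u → allowW X v →
    ∃ N : ℕ, ∀ k ≥ N, ∃ w : Fin k → A, allowW X (Fin.append (Fin.append u w) v)

/-- `M` is a mixing gap for the SFT `X`: any two symbols occurring in `X` are joined by an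
allowable word of length `M + 1` (this encodes `A^M > 0` for the transition matrix `A`). -/
def MixGap (X : Subshift A) (M : ℕ) : Prop :=
  ∀ a b : A, allowW X (fun _ : Fin 1 => a) → allowW X (fun _ : Fin 1 => b) →
    ∃ w : Fin (M + 1) → A, allowW X w ∧ w 0 = a ∧ w (Fin.last M) = b

/-- A Gibbs measure for the sequence of potentials `Φ` on the subshift `Y`: there are
`C > 0` and `P` with `1/C < μ[y₁⋯yₙ] / exp(-nP + φ_n(y)) < C` for all `y` and `n ≥ 1`. -/
def IsGibbs (Y : Subshift B) (Φ : ℕ → Y.pt → ℝ) (μ : ProbabilityMeasure Y.pt) : Prop :=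
  ∃ C : ℝ, 0 < C ∧ ∃ P : ℝ, ∀ n : ℕ, 0 < n → ∀ y : Y.pt,
    1 / C < (μ.toMeasure (cyl Y (fun i : Fin n => y.1 (i : ℕ)))).toReal /
        Real.exp (-(n : ℝ) * P + Φ n y) ∧
      (μ.toMeasure (cyl Y (fun i : Fin n => y.1 (i : ℕ)))).toReal /
        Real.exp (-(n : ℝ) * P + Φ n y) < C

/-- A measure is mixing for the map `f`. -/
def MixingM {Ω : Type*} [MeasurableSpace Ω] (f : Ω → Ω) (μ : Measure Ω) : Prop :=
  ∀ s t : Set Ω, MeasurableSet s → MeasurableSet t →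
    Filter.Tendsto (fun n : ℕ => (μ (s ∩ f^[n] ⁻¹' t)).toReal) Filter.atTop
      (nhds ((μ s).toReal * (μ t).toReal))

/-- The potential `φ_n(y) = log |π⁻¹[y₁⋯yₙ]|^{1/(α+1)}`. -/
noncomputable def phiPre (π : Factor X Y) (α : ℝ) (n : ℕ) (y : Y.pt) : ℝ :=
  Real.log (((preCnt π (fun i : Fin n => y.1 (i : ℕ)) : ℝ)) ^ (1 / (α + 1) : ℝ))

/-- The potential `φ'_n(y) = log |D_n(y)|^{1/(α+1)}`. -/
noncomputable def phiD (π : Factor X Y) (α : ℝ) (n : ℕ) (y : Y.pt) : ℝ :=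
  Real.log (((Dcnt π n y : ℝ)) ^ (1 / (α + 1) : ℝ))

/-- `S_n = ∑_{v ∈ B_n(Y)} |π⁻¹[v]|^{1/(α+1)}` (non-allowable words contribute `0` since
then `|π⁻¹[v]| = 0`). -/
noncomputable def Sval (π : Factor X Y) (α : ℝ) (n : ℕ) : ℝ :=
  ∑ v : Fin n → B, ((preCnt π v : ℝ)) ^ (1 / (α + 1) : ℝ)

/-- `M_{-F∘π + Φ∘π}(X, σ_X)` for `F = P(σ_X, π, 0)` and `Φ` a subadditive potential
on `Y`. -/
noncomputable def compEq (π : Factor X Y) (Φ : ℕ → Y.pt → ℝ) :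
    Set (ProbabilityMeasure X.pt) :=
  eqFP X (fun x => -relP π (π.map x)) (fun n x => Φ n (π.map x))

/-- The weighted entropy functional `h_μ(σ_X) + α h_{πμ}(σ_Y)`. -/
noncomputable def wtAlpha (π : Factor X Y) (α : ℝ) (μ : ProbabilityMeasure X.pt) : EReal :=
  (KS X μ : EReal) + (α : EReal) * (KS Y (π.push μ) : EReal)

/-- `K_α`: the set of invariant measures maximizing `h_μ(σ_X) + α h_{πμ}(σ_Y)`. -/
noncomputable def Kalpha (π : Factor X Y) (α : ℝ) : Set (ProbabilityMeasure X.pt) :=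
  {μ | μ ∈ invP X ∧ wtAlpha π α μ = sSup (wtAlpha π α '' invP X)}

end Defs

/-! ### The torus, the expanding map `T`, and carpets -/

/-- The two-torus. -/
abbrev T2 : Type := AddCircle (1 : ℝ) × AddCircle (1 : ℝ)

/-- The endomorphism `T(x, y) = (l x mod 1, m y mod 1)` of the torus. -/
noncomputable def Tmap (l m : ℕ) : T2 → T2 := fun p => (l • p.1, m • p.2)

/-- The coding map `χ` associated to the Markov partition of `T`. -/
noncomputable def chi (l m : ℕ) (x : ℕ → Fin l × Fin m) : T2 :=
  (((∑' k : ℕ, (((x k).1 : ℕ) : ℝ) / l ^ (k + 1) : ℝ) : AddCircle (1:ℝ)),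
   ((∑' k : ℕ, (((x k).2 : ℕ) : ℝ) / m ^ (k + 1) : ℝ) : AddCircle (1:ℝ)))

/-- The Hausdorff dimension of a measure: the infimum of the Hausdorff dimensions of
sets of full measure. -/
noncomputable def dimHMeas {Ω : Type*} [EMetricSpace Ω] [MeasurableSpace Ω]
    (μ : Measure Ω) : ℝ≥0∞ :=
  ⨅ (s : Set Ω) (_ : μ s = 1), dimH s

/-- `μ` is a `T`-invariant ergodic Borel probability measure of full Hausdorff
dimension for the compact invariant set `K`. -/
def FullDimErg (l m : ℕ) (K : Set T2) (μ : Measure T2) : Prop :=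
  IsProbabilityMeasure μ ∧ Ergodic (Tmap l m) μ ∧ μ K = 1 ∧ dimHMeas μ = dimH K

/-- The coding map restricted to a carpet subshift. -/
noncomputable def chiPt {l m : ℕ} (X : Subshift (Fin l × Fin m)) (x : X.pt) : T2 :=
  chi l m x.1


lemma aux_gibbs {p q : ℝ} (hp : 0 ≤ p) (hq : 0 ≤ q) (h : q = 0 → p = 0) :
    Real.negMulLog p + p * Real.log q ≤ q - p := by
  rcases hp.eq_or_lt with h0 | h0
  · subst h0; simpa using hq
  have hq' : 0 < q := lt_of_le_of_ne hq (fun e => h0.ne' (h e.symm))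
  have h1 := Real.log_le_sub_one_of_pos (div_pos hq' h0)
  rw [Real.log_div hq'.ne' h0.ne'] at h1
  have h2 := mul_le_mul_of_nonneg_left h1 h0.le
  have h3 : p * (q / p - 1) = q - p := by field_simp
  rw [h3] at h2
  unfold Real.negMulLog
  nlinarith

lemma aux_H_sub {S T : Type*} [Fintype S] [Fintype T] (p : S → T → ℝ)
    (hp : ∀ s t, 0 ≤ p s t) (h1 : ∑ s, ∑ t, p s t = 1) :
    ∑ s, ∑ t, Real.negMulLog (p s t) ≤
      ∑ s, Real.negMulLog (∑ t, p s t) + ∑ t, Real.negMulLog (∑ s, p s t) := by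
  set a : S → ℝ := fun s => ∑ t, p s t with ha
  set b : T → ℝ := fun t => ∑ s, p s t with hb
  have ha0 : ∀ s, 0 ≤ a s := fun s => Finset.sum_nonneg (fun t _ => hp s t)
  have hb0 : ∀ t, 0 ≤ b t := fun t => Finset.sum_nonneg (fun s _ => hp s t)
  have hpa : ∀ s t, a s = 0 → p s t = 0 := fun s t h =>
    (Finset.sum_eq_zero_iff_of_nonneg (fun t _ => hp s t)).1 h t (Finset.mem_univ _)
  have hpb : ∀ s t, b t = 0 → p s t = 0 := fun s t h =>
    (Finset.sum_eq_zero_iff_of_nonneg (fun s _ => hp s t)).1 h s (Finset.mem_univ _)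
  have key : ∀ s t, Real.negMulLog (p s t) ≤
      -(p s t * Real.log (a s)) - p s t * Real.log (b t) + (a s * b t - p s t) := by
    intro s t
    have := aux_gibbs (hp s t) (mul_nonneg (ha0 s) (hb0 t)) (fun h => by
      rcases mul_eq_zero.1 h with h | h
      · exact hpa s t h
      · exact hpb s t h)
    by_cases h0 : p s t = 0
    · have := mul_nonneg (ha0 s) (hb0 t)
      simp [h0]; exact this
    · rw [Real.log_mul (fun h => h0 (hpa s t h)) (fun h => h0 (hpb s t h))] at this
      linarith
  have hsa : ∑ s, a s = 1 := h1
  have hsb : ∑ t, b t = 1 := by rw [← h1]; exact Finset.sum_comm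
  calc ∑ s, ∑ t, Real.negMulLog (p s t)
      ≤ ∑ s, ∑ t, (-(p s t * Real.log (a s)) - p s t * Real.log (b t)
          + (a s * b t - p s t)) :=
        Finset.sum_le_sum (fun s _ => Finset.sum_le_sum (fun t _ => key s t))
    _ = (∑ s, ∑ t, -(p s t * Real.log (a s))) - (∑ s, ∑ t, p s t * Real.log (b t))
          + ((∑ s, ∑ t, a s * b t) - ∑ s, ∑ t, p s t) := by
        simp only [Finset.sum_add_distrib, Finset.sum_sub_distrib]
    _ = ∑ s, Real.negMulLog (a s) + ∑ t, Real.negMulLog (b t) := by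
        have e1 : ∑ s, ∑ t, a s * b t = 1 := by
          simp only [← Finset.mul_sum, hsb, mul_one, hsa]
        have e2 : (∑ s, ∑ t, -(p s t * Real.log (a s))) = ∑ s, Real.negMulLog (a s) := by
          refine Finset.sum_congr rfl (fun s _ => ?_)
          rw [Finset.sum_neg_distrib, ← Finset.sum_mul]; simp [Real.negMulLog, ha]
        have e3 : (∑ s, ∑ t, p s t * Real.log (b t)) = -∑ t, Real.negMulLog (b t) := by
          rw [Finset.sum_comm, ← Finset.sum_neg_distrib]
          refine Finset.sum_congr rfl (fun s _ => ?_)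
          rw [← Finset.sum_mul]; simp [Real.negMulLog, hb]
        rw [e1, e2, e3, h1]; ring

lemma aux_H_one {S : Type*} (G : Finset S) (p : S → ℝ) (hp : ∀ s, 0 ≤ p s) :
    ∑ s ∈ G, Real.negMulLog (p s) ≤
      Real.negMulLog (∑ s ∈ G, p s) + (∑ s ∈ G, p s) * Real.log G.card := by
  rcases G.eq_empty_or_nonempty with rfl | hG
  · simp
  have hc : (0 : ℝ) < G.card := by exact_mod_cast hG.card_pos
  set P := ∑ s ∈ G, p s with hP
  have hP0 : 0 ≤ P := Finset.sum_nonneg (fun s _ => hp s)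
  have hpP : ∀ s ∈ G, P = 0 → p s = 0 := fun s hs h =>
    (Finset.sum_eq_zero_iff_of_nonneg (fun s _ => hp s)).1 h s hs
  have key : ∀ s ∈ G, Real.negMulLog (p s) ≤
      -(p s * Real.log P) + p s * Real.log G.card + (P / G.card - p s) := by
    intro s hs
    have := aux_gibbs (hp s) (div_nonneg hP0 hc.le) (fun h => by
      rcases div_eq_zero_iff.1 h with h | h
      · exact hpP s hs h
      · exact absurd h hc.ne')
    by_cases h0 : p s = 0
    · have := div_nonneg hP0 hc.le
      simp [h0]; exact this
    · rw [Real.log_div (fun h => h0 (hpP s hs h)) hc.ne'] at this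
      linarith
  refine (Finset.sum_le_sum key).trans (le_of_eq ?_)
  rw [Finset.sum_add_distrib, Finset.sum_add_distrib, Finset.sum_sub_distrib,
    Finset.sum_neg_distrib, ← Finset.sum_mul, ← Finset.sum_mul, ← hP]
  simp only [Finset.sum_const, nsmul_eq_mul, Real.negMulLog]
  field_simp
  ring

lemma aux_H_fiber {S T : Type*} [Fintype S] [Fintype T] [DecidableEq T] (f : S → T) (good : S → Prop)
    (p : S → ℝ) (hp : ∀ s, 0 ≤ p s) (hg : ∀ s, ¬ good s → p s = 0) :
    ∑ s, Real.negMulLog (p s) ≤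
      ∑ t, (Real.negMulLog (∑ s with f s = t, p s) +
        (∑ s with f s = t, p s) *
          Real.log (Nat.card {s : S // good s ∧ f s = t})) := by
  rw [← Finset.sum_fiberwise Finset.univ f]
  refine Finset.sum_le_sum (fun t _ => ?_)
  have e : ∀ g : S → ℝ, (∀ s, ¬ good s → g s = 0) → ∑ s with f s = t, g s =
      ∑ s with good s ∧ f s = t, g s := by
    intro g hg
    rw [Finset.sum_filter, Finset.sum_filter]
    refine Finset.sum_congr rfl (fun s _ => ?_)
    by_cases h1 : good s
    · simp [h1]
    · simp [h1, hg s h1]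
  rw [e _ (fun s hs => by simp [hg s hs]), e p hg, Nat.card_eq_fintype_card,
    Fintype.card_subtype]
  exact aux_H_one _ p hp

lemma aux_window (a : ℕ → ℕ → ℝ) (C : ℝ) (hC0 : 0 ≤ C)
    (hsub : ∀ i n m, a i (n + m) ≤ a i n + a (i + n) m)
    (h0 : ∀ i n, 0 ≤ a i n) (hC : ∀ i n, a i n ≤ n * C) (q n : ℕ) :
    q * a 0 n ≤ ∑ i ∈ Finset.range n, a i q + 2 * q ^ 2 * C := by
  rcases lt_or_ge n q with hnq | hnq
  · have h1 := hC 0 n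
    have h2 : (n : ℝ) ≤ q := by exact_mod_cast hnq.le
    have h3 : 0 ≤ ∑ i ∈ Finset.range n, a i q := Finset.sum_nonneg (fun i _ => h0 i q)
    have h4 : a 0 n ≤ q * C := h1.trans (mul_le_mul_of_nonneg_right h2 hC0)
    have h5 : (q : ℝ) * a 0 n ≤ q * (q * C) := mul_le_mul_of_nonneg_left h4 (by positivity)
    have h6 : 0 ≤ (q:ℝ) ^ 2 * C := by positivity
    nlinarith
  have hW : ∀ p, p ≤ n - q + 1 → ∑ j ∈ Finset.range q, a j (n - j) ≤
      ∑ i ∈ Finset.range p, a i q + ∑ j ∈ Finset.range q, a (p + j) (n - (p + j)) := by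
    intro p
    induction p with
    | zero => intro _; simp
    | succ p ih =>
      intro hp
      refine (ih (by omega)).trans ?_
      rw [Finset.sum_range_succ (fun i => a i q)]
      have e : ∑ j ∈ Finset.range q, a (p + j) (n - (p + j)) + a (p + q) (n - (p + q)) =
          a p (n - p) + ∑ j ∈ Finset.range q, a (p + 1 + j) (n - (p + 1 + j)) := by
        rw [← Finset.sum_range_succ (fun j => a (p + j) (n - (p + j))), Finset.sum_range_succ']
        rw [add_comm]
        simp only [add_zero]
        congr 1
        refine Finset.sum_congr rfl (fun j _ => ?_)
        rw [show p + (j + 1) = p + 1 + j by ring]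
      have h := hsub p q (n - (p + q))
      rw [show q + (n - (p + q)) = n - p by omega] at h
      linarith
  have h1 := hW (n - q + 1) le_rfl
  have h2 : ∑ j ∈ Finset.range q, a (n - q + 1 + j) (n - (n - q + 1 + j)) ≤ q * (q * C) := by
    have : ∀ j ∈ Finset.range q, a (n - q + 1 + j) (n - (n - q + 1 + j)) ≤ q * C := by
      intro j hj
      refine (hC _ _).trans (mul_le_mul_of_nonneg_right ?_ hC0)
      exact_mod_cast (by omega : n - (n - q + 1 + j) ≤ q)
    refine (Finset.sum_le_sum this).trans ?_
    simp
  have h3 : ∑ i ∈ Finset.range (n - q + 1), a i q ≤ ∑ i ∈ Finset.range n, a i q ∨ q = 0 := by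
    rcases Nat.eq_zero_or_pos q with h | h
    · exact Or.inr h
    · left
      exact Finset.sum_le_sum_of_subset_of_nonneg
        (Finset.range_mono (by omega)) (fun i _ _ => h0 i q)
  have h4 : ∀ j ∈ Finset.range q, a 0 n ≤ q * C + a j (n - j) := by
    intro j hj
    have hj' := Finset.mem_range.1 hj
    have h := hsub 0 j (n - j)
    rw [show j + (n - j) = n by omega, zero_add] at h
    have h' : a 0 j ≤ q * C := (hC 0 j).trans
      (mul_le_mul_of_nonneg_right (by exact_mod_cast hj'.le) hC0)
    linarith
  have h5 := Finset.sum_le_sum h4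
  rw [Finset.sum_add_distrib] at h5
  simp only [Finset.sum_const, Finset.card_range, nsmul_eq_mul] at h5
  rcases h3 with h3 | h3
  · nlinarith
  · subst h3
    simp only [Nat.cast_zero, zero_mul]
    have : 0 ≤ ∑ i ∈ Finset.range n, a i 0 := Finset.sum_nonneg (fun i _ => h0 i 0)
    simpa using this


/-- Recursive maximal function of Birkhoff sums. -/
noncomputable def maxF {Ω : Type*} (T : Ω → Ω) (g : Ω → ℝ) : ℕ → Ω → ℝ
  | 0 => fun _ => 0
  | n + 1 => fun x => max 0 (g x + maxF T g n (T x))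

lemma maxF_nonneg {Ω : Type*} (T : Ω → Ω) (g : Ω → ℝ) (n : ℕ) (x : Ω) : 0 ≤ maxF T g n x := by
  cases n with
  | zero => exact le_rfl
  | succ n => exact le_max_left _ _

lemma maxF_le_succ {Ω : Type*} (T : Ω → Ω) (g : Ω → ℝ) (n : ℕ) (x : Ω) :
    maxF T g n x ≤ maxF T g (n + 1) x := by
  induction n generalizing x with
  | zero => exact maxF_nonneg T g 1 x
  | succ n ih =>
    change max 0 (g x + maxF T g n (T x)) ≤ max 0 (g x + maxF T g (n + 1) (T x))
    have := ih (T x)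
    gcongr

lemma sum_le_maxF {Ω : Type*} (T : Ω → Ω) (g : Ω → ℝ) (n : ℕ) (x : Ω) :
    birkhoffSum T g n x ≤ maxF T g n x := by
  induction n generalizing x with
  | zero => simp [maxF]
  | succ n ih =>
    rw [birkhoffSum_succ']
    exact (add_le_add_right (ih (T x)) _).trans (le_max_right _ _)

lemma maxF_le {Ω : Type*} (T : Ω → Ω) (g : Ω → ℝ) (C : ℝ) (hC0 : 0 ≤ C)
    (hC : ∀ x, |g x| ≤ C) (n : ℕ) (x : Ω) : maxF T g n x ≤ n * C := by
  induction n generalizing x with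
  | zero => simp [maxF]
  | succ n ih =>
    have h1 := ih (T x)
    have h2 := (le_abs_self _).trans (hC x)
    have h3 : (0:ℝ) ≤ n := by positivity
    push_cast
    exact max_le (by positivity) (by linarith)

lemma measurable_maxF {Ω : Type*} [MeasurableSpace Ω] (T : Ω → Ω) (hT : Measurable T)
    (g : Ω → ℝ) (hg : Measurable g) (n : ℕ) : Measurable (maxF T g n) := by
  induction n with
  | zero => exact measurable_const
  | succ n ih => exact measurable_const.max (hg.add (ih.comp hT))

lemma aux_integrable {Ω : Type*} [MeasurableSpace Ω] (μ : Measure Ω) [IsProbabilityMeasure μ]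
    {g : Ω → ℝ} (hg : Measurable g) (C : ℝ) (hC : ∀ x, |g x| ≤ C) : Integrable g μ :=
  Integrable.of_bound hg.aestronglyMeasurable C (ae_of_all _ hC)

lemma aux_maximal {Ω : Type*} [MeasurableSpace Ω] (μ : Measure Ω) [IsProbabilityMeasure μ]
    (T : Ω → Ω) (hT : MeasurePreserving T μ μ)
    (g : Ω → ℝ) (hg : Measurable g) (C : ℝ) (hC : ∀ x, |g x| ≤ C)
    (hpos : ∀ x, ∃ n, 0 < birkhoffSum T g n x) : 0 ≤ ∫ x, g x ∂μ := by
  have hne : Nonempty Ω := by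
    by_contra h
    rw [not_nonempty_iff] at h
    have : μ univ = 0 := by rw [Set.eq_empty_of_isEmpty (univ : Set Ω)]; simp
    simp at this
  have hC0 : 0 ≤ C := (abs_nonneg _).trans (hC hne.some)
  have hM := fun n => measurable_maxF T hT.measurable g hg n
  have hgi := aux_integrable μ hg C hC
  have hMi : ∀ n, Integrable (maxF T g n) μ := fun n =>
    aux_integrable μ (hM n) (n * C) (fun x => by
      rw [abs_of_nonneg (maxF_nonneg _ _ _ _)]; exact maxF_le T g C hC0 hC n x)
  have hset : ∀ n, MeasurableSet {x | 0 < maxF T g n x} := fun n =>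
    measurableSet_lt measurable_const (hM n)
  have h1 : ∀ n, 0 ≤ ∫ x, ({x | 0 < maxF T g (n + 1) x} : Set Ω).indicator g x ∂μ := by
    intro n
    have hc : ∫ x, maxF T g n (T x) ∂μ = ∫ x, maxF T g n x ∂μ := by
      conv_rhs => rw [← hT.map_eq]
      rw [integral_map hT.measurable.aemeasurable (hM n).aestronglyMeasurable]
    have hci : Integrable (fun x => maxF T g n (T x)) μ :=
      hT.integrable_comp_of_integrable (hMi n)
    have h2 : ∫ x, maxF T g (n + 1) x ∂μ ≤
        ∫ x, (({x | 0 < maxF T g (n + 1) x} : Set Ω).indicator g x + maxF T g n (T x)) ∂μ := by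
      refine integral_mono (hMi _) ((hgi.indicator (hset _)).add hci) (fun x => ?_)
      by_cases hx : 0 < maxF T g (n + 1) x
      · simp only [indicator, mem_ofPred_eq, hx, if_true]
        have : maxF T g (n + 1) x = max 0 (g x + maxF T g n (T x)) := rfl
        rw [this] at hx ⊢
        rcases lt_max_iff.1 hx with h | h
        · exact absurd h (lt_irrefl _)
        · rw [max_eq_right h.le]
      · simp only [indicator, mem_ofPred_eq, hx, if_false]
        have := maxF_nonneg T g n (T x)
        linarith
    rw [integral_add (hgi.indicator (hset _)) hci, hc] at h2
    have h3 : ∫ x, maxF T g n x ∂μ ≤ ∫ x, maxF T g (n + 1) x ∂μ :=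
      integral_mono (hMi _) (hMi _) (fun x => maxF_le_succ T g n x)
    linarith
  have hlim : Tendsto (fun n => ∫ x, ({x | 0 < maxF T g (n + 1) x} : Set Ω).indicator g x ∂μ)
      atTop (𝓝 (∫ x, g x ∂μ)) := by
    refine tendsto_integral_of_dominated_convergence (fun _ => C) (fun n =>
      (hg.indicator (hset _)).aestronglyMeasurable) (integrable_const _) (fun n =>
        ae_of_all _ (fun x => ?_)) (ae_of_all _ (fun x => ?_))
    · exact (norm_indicator_le_norm_self _ _).trans (hC x)
    · obtain ⟨k, hk⟩ := hpos x
      refine tendsto_const_nhds.congr' ?_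
      filter_upwards [eventually_ge_atTop k] with n hn
      have : 0 < maxF T g (n + 1) x := by
        have hm : Monotone (fun n => maxF T g n x) :=
          monotone_nat_of_le_succ (fun n => maxF_le_succ T g n x)
        exact (hk.trans_le (sum_le_maxF T g k x)).trans_le (hm (by omega))
      simp [indicator, this]
  exact ge_of_tendsto' hlim h1

lemma aux_bdd {u : ℕ → ℝ} {C : ℝ} (h : ∀ n, |u n| ≤ C) :
    IsBoundedUnder (· ≤ ·) atTop u ∧ IsBoundedUnder (· ≥ ·) atTop u ∧
    IsCoboundedUnder (· ≤ ·) atTop u := by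
  have h1 : IsBoundedUnder (· ≤ ·) atTop u :=
    ⟨C, eventually_map.2 (Eventually.of_forall fun n => (le_abs_self _).trans (h n))⟩
  have h2 : IsBoundedUnder (· ≥ ·) atTop u :=
    ⟨-C, eventually_map.2 (Eventually.of_forall fun n => (abs_le.1 (h n)).1)⟩
  exact ⟨h1, h2, h2.isCoboundedUnder_flip⟩

lemma aux_abs_limsup {u : ℕ → ℝ} {C : ℝ} (h : ∀ n, |u n| ≤ C) : |limsup u atTop| ≤ C := by
  obtain ⟨h1, h2, h3⟩ := aux_bdd h
  rw [abs_le]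
  constructor
  · exact le_limsup_of_frequently_le
      (Eventually.of_forall fun n => (abs_le.1 (h n)).1).frequently h1
  · exact limsup_le_of_le h3 (Eventually.of_forall fun n => (abs_le.1 (h n)).2)

lemma aux_birk {Ω : Type*} [MeasurableSpace Ω] (μ : Measure Ω) [IsProbabilityMeasure μ]
    (T : Ω → Ω) (hT : MeasurePreserving T μ μ)
    (f : Ω → ℝ) (hf : Measurable f) (C : ℝ) (hC : ∀ x, |f x| ≤ C) :
    ∫ x, limsup (fun n : ℕ => birkhoffSum T f n x / n) atTop ∂μ ≤ ∫ x, f x ∂μ := by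
  set fb : Ω → ℝ := fun x => limsup (fun n : ℕ => birkhoffSum T f n x / n) atTop with hfb
  have hb : ∀ x n, |birkhoffSum T f n x / n| ≤ C := by
    intro x n
    have hC0 : 0 ≤ C := (abs_nonneg _).trans (hC x)
    rcases Nat.eq_zero_or_pos n with rfl | hn
    · simpa using hC0
    have hn' : (0:ℝ) < n := by exact_mod_cast hn
    rw [abs_div, abs_of_pos hn', div_le_iff₀ hn']
    refine (Finset.abs_sum_le_sum_abs _ _).trans
      ((Finset.sum_le_sum (fun i _ => hC (T^[i] x))).trans (le_of_eq ?_))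
    simp [mul_comm]
  have hfbm : Measurable fb := by
    refine Measurable.limsup (fun n => ?_)
    refine Measurable.div_const ?_ _
    unfold birkhoffSum
    exact Finset.measurable_sum _ (fun i _ => hf.comp (hT.measurable.iterate i))
  have hfbC : ∀ x, |fb x| ≤ C := fun x => aux_abs_limsup (hb x)
  have hinv1 : ∀ x, fb (T x) ≤ fb x := by
    intro x
    have hC0 : 0 ≤ C := (abs_nonneg _).trans (hC x)
    refine le_of_forall_pos_le_add (fun ε hε => ?_)
    refine limsup_le_of_le (aux_bdd (hb (T x))).2.2 ?_
    have h1 : ∀ᶠ n : ℕ in atTop, birkhoffSum T f n x / n < fb x + ε / 2 :=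
      eventually_lt_of_limsup_lt (by change fb x < _; linarith) (aux_bdd (hb x)).1
    have h2 := (tendsto_add_atTop_nat 1).eventually h1
    obtain ⟨K, hK⟩ := exists_nat_gt ((2 * C + ε / 2) / (ε / 2))
    filter_upwards [h2, eventually_ge_atTop K, eventually_gt_atTop 0] with n hn hnK hn0
    have hn' : (0:ℝ) < n := by exact_mod_cast hn0
    have hnK' : (K:ℝ) ≤ n := by exact_mod_cast hnK
    rw [div_lt_iff₀ (by positivity)] at hn
    rw [birkhoffSum_succ'] at hn
    rw [div_le_iff₀ hn']
    have h3 := (abs_le.1 (hC x)).1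
    have h4 := (abs_le.1 (hfbC x)).2
    push_cast at hn
    rw [div_lt_iff₀ (by positivity)] at hK
    have h5 : (K:ℝ) * (ε / 2) ≤ n * (ε / 2) := by gcongr
    nlinarith
  have hinv : ∀ x i, fb (T^[i] x) ≤ fb x := by
    intro x i
    induction i with
    | zero => simp
    | succ i ih => rw [Function.iterate_succ_apply']; exact (hinv1 _).trans ih
  refine le_of_forall_pos_le_add (fun ε hε => ?_)
  have hfi := aux_integrable μ hf C hC
  have hfbi := aux_integrable μ hfbm C hfbC
  have key : 0 ≤ ∫ x, (f x - fb x + ε) ∂μ := by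
    refine aux_maximal μ T hT _ ((hf.sub hfbm).add_const ε) (C + C + ε) (fun x => ?_)
      (fun x => ?_)
    · have h1 := abs_le.1 (hC x)
      have h2 := abs_le.1 (hfbC x)
      rw [abs_le]; constructor <;> linarith [h1.1, h1.2, h2.1, h2.2]
    · have h1 : ∃ᶠ n : ℕ in atTop, fb x - ε < birkhoffSum T f n x / n :=
        frequently_lt_of_lt_limsup (aux_bdd (hb x)).2.2 (by change _ < fb x; linarith)
      obtain ⟨n, hn, hn0⟩ := (h1.and_eventually (eventually_gt_atTop 0)).exists
      refine ⟨n, ?_⟩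
      have hn' : (0:ℝ) < n := by exact_mod_cast hn0
      rw [lt_div_iff₀ hn'] at hn
      have h2 : birkhoffSum T (fun x => f x - fb x + ε) n x =
          birkhoffSum T f n x - ∑ i ∈ Finset.range n, fb (T^[i] x) + n * ε := by
        simp [birkhoffSum, Finset.sum_add_distrib, Finset.sum_sub_distrib]
      have h3 : ∑ i ∈ Finset.range n, fb (T^[i] x) ≤ n * fb x := by
        refine (Finset.sum_le_sum (fun i _ => hinv x i)).trans (le_of_eq ?_)
        simp
      rw [h2]
      nlinarith
  have hsb : Integrable (fun x => f x - fb x) μ := hfi.sub hfbi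
  rw [integral_add hsb (integrable_const _), integral_sub hfi hfbi] at key
  simp at key
  linarith

lemma aux_revFatou {Ω : Type*} [MeasurableSpace Ω] (μ : Measure Ω) [IsProbabilityMeasure μ]
    (g : ℕ → Ω → ℝ) (hg : ∀ n, Measurable (g n)) (C : ℝ) (h0 : ∀ n x, 0 ≤ g n x)
    (hC : ∀ n x, g n x ≤ C) (c : ℝ) (hc : ∀ᶠ n in atTop, c ≤ ∫ x, g n x ∂μ) :
    c ≤ ∫ x, limsup (fun n => g n x) atTop ∂μ := by
  have hb : ∀ x n, |g n x| ≤ C := fun x n => by rw [abs_of_nonneg (h0 n x)]; exact hC n x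
  have hm : Measurable (fun x => limsup (fun n => g n x) atTop) := Measurable.limsup hg
  have hL0 : ∀ x, 0 ≤ limsup (fun n => g n x) atTop := fun x =>
    le_limsup_of_frequently_le (Eventually.of_forall fun n => h0 n x).frequently
      (aux_bdd (hb x)).1
  have h1 := limsup_lintegral_le (μ := μ) (f := fun n x => ENNReal.ofReal (g n x))
    (fun _ => ENNReal.ofReal C)
    (fun n => (hg n).ennreal_ofReal) (fun n => ae_of_all _ fun x =>
      ENNReal.ofReal_le_ofReal (hC n x)) (by simp)
  have h2 : ∀ x, limsup (fun n => ENNReal.ofReal (g n x)) atTop =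
      ENNReal.ofReal (limsup (fun n => g n x) atTop) := by
    intro x
    obtain ⟨a, b, d⟩ := aux_bdd (hb x)
    have := Monotone.map_limsup_of_continuousAt (F := atTop) (f := ENNReal.ofReal)
      (fun _ _ h => ENNReal.ofReal_le_ofReal h) (fun n => g n x)
      ENNReal.continuous_ofReal.continuousAt a d
    exact this.symm
  simp_rw [h2] at h1
  have hLi := aux_integrable μ hm C (fun x => aux_abs_limsup (hb x))
  have h3 : ENNReal.ofReal c ≤ ENNReal.ofReal (∫ x, limsup (fun n => g n x) atTop ∂μ) := by
    rw [ofReal_integral_eq_lintegral_ofReal hLi (ae_of_all _ hL0)]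
    refine le_trans ?_ h1
    refine le_limsup_of_frequently_le (Eventually.frequently ?_) (by isBoundedDefault)
    filter_upwards [hc] with n hn
    rw [← ofReal_integral_eq_lintegral_ofReal (aux_integrable μ (hg n) C (fun x => hb x n))
      (ae_of_all _ (h0 n))]
    exact ENNReal.ofReal_le_ofReal hn
  rwa [ENNReal.ofReal_le_ofReal_iff (integral_nonneg hL0)] at h3


section Words

variable {A B : Type*}
  [Fintype A] [TopologicalSpace A] [DiscreteTopology A]
  [MeasurableSpace A] [MeasurableSingletonClass A]
  [Fintype B] [TopologicalSpace B] [DiscreteTopology B]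
  [MeasurableSpace B] [MeasurableSingletonClass B]

/-- The initial word of length `n`. -/
def wd (X : Subshift A) (n : ℕ) (x : X.pt) : Fin n → A := fun i => x.1 i

lemma measurable_wd (X : Subshift A) (n : ℕ) : Measurable (wd X n) := by
  apply measurable_pi_lambda
  intro i
  exact (measurable_pi_apply _).comp measurable_subtype_coe

lemma continuous_wd (X : Subshift A) (n : ℕ) : Continuous (wd X n) := by
  apply continuous_pi
  intro i
  exact (continuous_apply _).comp continuous_subtype_val

lemma measurable_sigma (X : Subshift A) : Measurable X.σ := by
  apply Measurable.subtype_mk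
  apply measurable_pi_lambda
  intro i
  exact (measurable_pi_apply _).comp measurable_subtype_coe

lemma continuous_sigma (X : Subshift A) : Continuous X.σ := by
  apply Continuous.subtype_mk
  apply continuous_pi
  intro i
  exact (continuous_apply _).comp continuous_subtype_val

lemma sigma_iter (X : Subshift A) (n : ℕ) (x : X.pt) (i : ℕ) :
    (X.σ^[n] x).1 i = x.1 (n + i) := by
  induction n generalizing x with
  | zero => simp
  | succ n ih =>
    rw [Function.iterate_succ_apply, ih]
    change x.1 (n + i + 1) = _
    rw [show n + i + 1 = n + 1 + i by ring]

instance (X : Subshift A) : CompactSpace X.pt := isCompact_iff_compactSpace.1 X.isClosed.isCompact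

variable {X : Subshift A} {Y : Subshift B}

/-- Words of length `n` in `X` extendable so that the image begins with `v`. -/
def wset (π : Factor X Y) (n : ℕ) {N : ℕ} (v : Fin N → B) : Set (Fin n → A) :=
  {w | ∃ x : X.pt, wd X n x = w ∧ wd Y N (π.map x) = v}

/-- Words of length `n` in the fibre of `y`. -/
def dset (π : Factor X Y) (n : ℕ) (y : Y.pt) : Set (Fin n → A) :=
  {w | ∃ x : X.pt, wd X n x = w ∧ π.map x = y}

lemma Factor.map_surj (π : Factor X Y) (y : Y.pt) : ∃ x, π.map x = y := by
  obtain ⟨x, hx, h⟩ := π.surj y.1 y.2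
  exact ⟨⟨x, hx⟩, Subtype.ext h⟩

lemma Factor.continuous_map (π : Factor X Y) : Continuous π.map := by
  apply Continuous.subtype_mk
  apply continuous_pi
  intro i
  exact (continuous_of_discreteTopology (f := π.symb)).comp
    ((continuous_apply i).comp continuous_subtype_val)

lemma Factor.map_sigma (π : Factor X Y) (x : X.pt) : π.map (X.σ x) = Y.σ (π.map x) := rfl

lemma Factor.map_sigma_iter (π : Factor X Y) (n : ℕ) (x : X.pt) :
    π.map (X.σ^[n] x) = Y.σ^[n] (π.map x) := by
  induction n generalizing x with
  | zero => rfl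
  | succ n ih => rw [Function.iterate_succ_apply, ih, π.map_sigma, Function.iterate_succ_apply]

lemma preCnt_eq (π : Factor X Y) {n : ℕ} (v : Fin n → B) : preCnt π v = (wset π n v).ncard := by
  unfold preCnt
  have : wset π n v = {w | allowW X w ∧ ∀ i, π.symb (w i) = v i} := by
    ext w
    constructor
    · rintro ⟨x, rfl, rfl⟩
      exact ⟨⟨x.1, x.2, fun i => rfl⟩, fun i => rfl⟩
    · rintro ⟨⟨x, hx, h⟩, h2⟩
      refine ⟨⟨x, hx⟩, funext h, funext fun i => ?_⟩
      rw [← h2 i, ← h i]; rfl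
  rw [this]
  rfl

lemma Dcnt_eq (π : Factor X Y) (n : ℕ) (y : Y.pt) : Dcnt π n y = (dset π n y).ncard := by
  unfold Dcnt
  have : dset π n y = {w | ∃ x : X.pt, π.map x = y ∧ ∀ i : Fin n, x.1 (i : ℕ) = w i} := by
    ext w
    constructor
    · rintro ⟨x, rfl, h⟩
      exact ⟨x, h, fun i => rfl⟩
    · rintro ⟨x, h, h2⟩
      exact ⟨x, funext h2, h⟩
  rw [this]
  rfl

/-- Logarithmic count. -/
noncomputable def LE (π : Factor X Y) (n N : ℕ) (y : Y.pt) : ℝ :=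
  Real.log ((wset π n (wd Y N y)).ncard)

lemma wset_nonempty (π : Factor X Y) (n N : ℕ) (y : Y.pt) : (wset π n (wd Y N y)).Nonempty := by
  obtain ⟨x, rfl⟩ := π.map_surj y
  exact ⟨_, x, rfl, rfl⟩

lemma dset_nonempty (π : Factor X Y) (n : ℕ) (y : Y.pt) : (dset π n y).Nonempty := by
  obtain ⟨x, rfl⟩ := π.map_surj y
  exact ⟨_, x, rfl, rfl⟩

lemma dset_subset (π : Factor X Y) (n N : ℕ) (y : Y.pt) : dset π n y ⊆ wset π n (wd Y N y) := by
  rintro w ⟨x, h, rfl⟩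
  exact ⟨x, h, rfl⟩

lemma aux_log_ncard {n : ℕ} {s : Set (Fin n → A)} (hs : s.Nonempty) :
    0 ≤ Real.log s.ncard ∧ Real.log s.ncard ≤ n * Real.log (Fintype.card A) := by
  have h1 : 1 ≤ s.ncard := (Set.ncard_pos (Set.toFinite s)).2 hs
  have h2 : s.ncard ≤ Fintype.card A ^ n := by
    have := Set.ncard_le_card s
    simpa using this
  constructor
  · exact Real.log_natCast_nonneg _
  · rw [← Real.log_pow]
    exact Real.log_le_log (by exact_mod_cast h1) (by exact_mod_cast h2)

lemma LE_nonneg (π : Factor X Y) (n N : ℕ) (y : Y.pt) : 0 ≤ LE π n N y :=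
  (aux_log_ncard (wset_nonempty π n N y)).1

lemma LE_le (π : Factor X Y) (n N : ℕ) (y : Y.pt) :
    LE π n N y ≤ n * Real.log (Fintype.card A) :=
  (aux_log_ncard (wset_nonempty π n N y)).2

lemma LE_abs (π : Factor X Y) (n N : ℕ) (y : Y.pt) :
    |LE π n N y| ≤ n * Real.log (Fintype.card A) := by
  rw [abs_of_nonneg (LE_nonneg _ _ _ _)]; exact LE_le _ _ _ _

lemma measurable_LE (π : Factor X Y) (n N : ℕ) : Measurable (LE π n N) :=
  (measurable_of_countable
    (fun v : Fin N → B => Real.log ((wset π n v).ncard))).comp (measurable_wd Y N)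

lemma LE_sub (π : Factor X Y) (n k N K M : ℕ) (hN : N ≤ M) (hK : n + K ≤ M) (y : Y.pt) :
    LE π (n + k) M y ≤ LE π n N y + LE π k K (Y.σ^[n] y) := by
  unfold LE
  have hp : ∀ n N (y : Y.pt), (0:ℝ) < (wset π n (wd Y N y)).ncard := fun n N y => by
    exact_mod_cast (Set.ncard_pos (Set.toFinite _)).2 (wset_nonempty π n N y)
  rw [← Real.log_mul (hp _ _ _).ne' (hp _ _ _).ne']
  refine Real.log_le_log (hp _ _ _) ?_
  rw [← Nat.cast_mul, ← Set.ncard_prod]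
  refine Nat.cast_le.2 (Set.ncard_le_ncard_of_injOn
    (fun w : Fin (n + k) → A => (fun i : Fin n => w (Fin.castAdd k i),
      fun i : Fin k => w (Fin.natAdd n i))) ?_ ?_ (Set.toFinite _))
  · rintro w ⟨x, rfl, hx⟩
    refine ⟨⟨x, rfl, ?_⟩, ⟨X.σ^[n] x, ?_, ?_⟩⟩
    · funext i
      exact congrFun hx ⟨i, i.2.trans_le hN⟩
    · funext i
      simp only [wd, sigma_iter, Fin.val_natAdd]
    · funext i
      rw [π.map_sigma_iter]
      simp only [wd, sigma_iter]
      exact congrFun hx ⟨n + i, by omega⟩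
  · intro w _ w' _ h
    simp only [Prod.mk.injEq] at h
    funext i
    refine Fin.addCases (fun j => congrFun h.1 j) (fun j => congrFun h.2 j) i

lemma dset_eventually (π : Factor X Y) (n : ℕ) (y : Y.pt) :
    ∀ᶠ N in atTop, wset π n (wd Y N y) = dset π n y := by
  have h1 : ∀ w : Fin n → A, ∀ᶠ N in atTop, w ∈ wset π n (wd Y N y) → w ∈ dset π n y := by
    intro w
    by_contra hcon
    rw [not_eventually] at hcon
    have hw : w ∉ dset π n y := by
      obtain ⟨N, hN⟩ := hcon.exists
      tauto
    have hall : ∀ N, w ∈ wset π n (wd Y N y) := by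
      intro N
      obtain ⟨M, hM, hNM⟩ := (hcon.and_eventually (eventually_ge_atTop N)).exists
      have : w ∈ wset π n (wd Y M y) := by tauto
      obtain ⟨x, hx, hx2⟩ := this
      exact ⟨x, hx, funext fun i => congrFun hx2 ⟨i, i.2.trans_le hNM⟩⟩
    let K : ℕ → Set X.pt := fun N => wd X n ⁻¹' {w} ∩ (fun x => wd Y N (π.map x)) ⁻¹' {wd Y N y}
    have hKc : ∀ N, IsClosed (K N) := fun N =>
      ((isClosed_singleton).preimage (continuous_wd X n)).inter
        ((isClosed_singleton).preimage ((continuous_wd Y N).comp π.continuous_map))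
    have hne : (⋂ N, K N).Nonempty := by
      refine IsCompact.nonempty_iInter_of_sequence_nonempty_isCompact_isClosed K ?_ ?_
        ((hKc 0).isCompact) hKc
      · rintro N x ⟨hx, hx2⟩
        exact ⟨hx, funext fun i => congrFun hx2 ⟨i, i.2.trans (Nat.lt_succ_self N)⟩⟩
      · intro N
        obtain ⟨x, hx, hx2⟩ := hall N
        exact ⟨x, hx, hx2⟩
    obtain ⟨x, hx⟩ := hne
    rw [mem_iInter] at hx
    refine hw ⟨x, (hx 0).1, Subtype.ext (funext fun i => ?_)⟩
    exact congrFun (hx (i + 1)).2 ⟨i, Nat.lt_succ_self i⟩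
  have h2 := eventually_all.2 h1
  filter_upwards [h2] with N hN
  exact Set.Subset.antisymm (fun w hw => hN w hw) (dset_subset π n N y)

lemma logD_tendsto (π : Factor X Y) (n : ℕ) (y : Y.pt) :
    Tendsto (fun N => LE π n N y) atTop (𝓝 (Real.log (Dcnt π n y))) := by
  refine tendsto_const_nhds.congr' ?_
  filter_upwards [dset_eventually π n y] with N hN
  rw [LE, hN, Dcnt_eq]

lemma logD_measurable (π : Factor X Y) (n : ℕ) :
    Measurable (fun y => Real.log (Dcnt π n y)) :=
  measurable_of_tendsto_metrizable (fun N => measurable_LE π n N)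
    (tendsto_pi_nhds.2 (fun y => logD_tendsto π n y))

lemma logD_bound (π : Factor X Y) (n : ℕ) (y : Y.pt) :
    0 ≤ Real.log (Dcnt π n y) / n ∧ Real.log (Dcnt π n y) / n ≤ Real.log (Fintype.card A) := by
  have h := aux_log_ncard (dset_nonempty π n y)
  rw [← Dcnt_eq] at h
  refine ⟨div_nonneg h.1 (by positivity), ?_⟩
  rcases Nat.eq_zero_or_pos n with rfl | hn
  · simpa using Real.log_natCast_nonneg _
  · rw [div_le_iff₀ (by exact_mod_cast hn), mul_comm]; exact h.2

lemma logD_abs (π : Factor X Y) (y : Y.pt) (n : ℕ) :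
    |Real.log (Dcnt π n y) / n| ≤ Real.log (Fintype.card A) := by
  rw [abs_of_nonneg (logD_bound π n y).1]; exact (logD_bound π n y).2

lemma logD_le_LE (π : Factor X Y) (n N : ℕ) (y : Y.pt) :
    Real.log (Dcnt π n y) ≤ LE π n N y := by
  rw [Dcnt_eq]
  refine Real.log_le_log ?_ ?_
  · exact_mod_cast (Set.ncard_pos (Set.toFinite _)).2 (dset_nonempty π n y)
  · exact_mod_cast Set.ncard_le_ncard (dset_subset π n N y) (Set.toFinite _)

lemma relP_measurable (π : Factor X Y) : Measurable (relP π) :=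
  Measurable.limsup (fun n => (logD_measurable π n).div_const _)

lemma relP_abs (π : Factor X Y) (y : Y.pt) : |relP π y| ≤ Real.log (Fintype.card A) :=
  aux_abs_limsup (logD_abs π y)

lemma invP_mp {m : ProbabilityMeasure Y.pt} (hm : m ∈ invP Y) :
    MeasurePreserving Y.σ m.toMeasure m.toMeasure := ⟨measurable_sigma Y, hm⟩

lemma relP_le (π : Factor X Y) (m : ProbabilityMeasure Y.pt) (hm : m ∈ invP Y) (q : ℕ)
    (hq : 0 < q) : q * ∫ y, relP π y ∂m.toMeasure ≤ ∫ y, LE π q q y ∂m.toMeasure := by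
  set C := Real.log (Fintype.card A) with hCdef
  have hC0 : 0 ≤ C := Real.log_natCast_nonneg _
  have hq' : (0:ℝ) < q := by exact_mod_cast hq
  set f : Y.pt → ℝ := fun y => LE π q q y / q with hf
  have hfm : Measurable f := (measurable_LE π q q).div_const _
  have hfC : ∀ y, |f y| ≤ C := by
    intro y
    rw [hf, abs_div, abs_of_pos hq', div_le_iff₀ hq', mul_comm]
    exact LE_abs π q q y
  have hB := aux_birk m.toMeasure Y.σ (invP_mp hm) f hfm C hfC
  have hb : ∀ x n, |birkhoffSum Y.σ f n x / n| ≤ C := by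
    intro x n
    rcases Nat.eq_zero_or_pos n with rfl | hn
    · simpa using hC0
    have hn' : (0:ℝ) < n := by exact_mod_cast hn
    rw [abs_div, abs_of_pos hn', div_le_iff₀ hn']
    refine (Finset.abs_sum_le_sum_abs _ _).trans
      ((Finset.sum_le_sum (fun i _ => hfC (Y.σ^[i] x))).trans (le_of_eq ?_))
    simp [mul_comm]
  have hpt : ∀ y, relP π y ≤ limsup (fun n : ℕ => birkhoffSum Y.σ f n y / n) atTop := by
    intro y
    refine le_of_forall_pos_le_add (fun ε hε => ?_)
    refine limsup_le_of_le (aux_bdd (logD_abs π y)).2.2 ?_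
    have h1 : ∀ᶠ n : ℕ in atTop, birkhoffSum Y.σ f n y / n <
        limsup (fun n : ℕ => birkhoffSum Y.σ f n y / n) atTop + ε / 2 :=
      eventually_lt_of_limsup_lt (by linarith) (aux_bdd (hb y)).1
    obtain ⟨K, hK⟩ := exists_nat_gt (2 * q * C / (ε / 2))
    filter_upwards [h1, eventually_ge_atTop K, eventually_gt_atTop 0] with n hn hnK hn0
    have hn' : (0:ℝ) < n := by exact_mod_cast hn0
    have hnK' : (K:ℝ) ≤ n := by exact_mod_cast hnK
    have hw := aux_window (fun i n => LE π n n (Y.σ^[i] y)) C hC0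
      (fun i n k => by
        have := LE_sub π n k n k (n + k) (by omega) le_rfl (Y.σ^[i] y)
        rwa [← Function.iterate_add_apply, Nat.add_comm n i] at this)
      (fun i n => LE_nonneg _ _ _ _) (fun i n => LE_le _ _ _ _) q n
    simp only [Function.iterate_zero, id] at hw
    have h2 : ∑ i ∈ Finset.range n, LE π q q (Y.σ^[i] y) = q * birkhoffSum Y.σ f n y := by
      simp only [birkhoffSum, hf, Finset.mul_sum]
      refine Finset.sum_congr rfl (fun i _ => ?_)
      field_simp
    rw [h2] at hw
    have h3 : LE π n n y ≤ birkhoffSum Y.σ f n y + 2 * q * C := by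
      have : (q:ℝ) * LE π n n y ≤ q * (birkhoffSum Y.σ f n y + 2 * q * C) := by
        nlinarith
      exact le_of_mul_le_mul_left this hq'
    rw [div_lt_iff₀ hn'] at hn
    rw [div_le_iff₀ hn']
    rw [div_lt_iff₀ (by positivity)] at hK
    have h5 : (K:ℝ) * (ε / 2) ≤ n * (ε / 2) := by gcongr
    have h6 := logD_le_LE π n n y
    nlinarith
  have hlm : Measurable (fun y => limsup (fun n : ℕ => birkhoffSum Y.σ f n y / n) atTop) := by
    refine Measurable.limsup (fun n => ?_)
    refine Measurable.div_const ?_ _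
    unfold birkhoffSum
    exact Finset.measurable_sum _ (fun i _ => hfm.comp ((measurable_sigma Y).iterate i))
  have h7 : ∫ y, relP π y ∂m.toMeasure ≤ ∫ y, f y ∂m.toMeasure :=
    (integral_mono (aux_integrable _ (relP_measurable π) C (relP_abs π))
      (aux_integrable _ hlm C (fun y => aux_abs_limsup (hb y))) hpt).trans hB
  have h8 : ∫ y, f y ∂m.toMeasure = (∫ y, LE π q q y ∂m.toMeasure) / q := by
    simp only [hf, integral_div]
  rw [h8, le_div_iff₀ hq'] at h7
  linarith

lemma LE_block (π : Factor X Y) (m : ProbabilityMeasure Y.pt) (hm : m ∈ invP Y) (n N k : ℕ) :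
    ∫ y, LE π (k * n + N) (k * n + N) y ∂m.toMeasure ≤
      k * ∫ y, LE π n N y ∂m.toMeasure + ∫ y, LE π N N y ∂m.toMeasure := by
  have hi : ∀ n N, Integrable (LE π n N) m.toMeasure := fun n N =>
    aux_integrable _ (measurable_LE π n N) _ (LE_abs π n N)
  have hinv : ∀ n N k, ∫ y, LE π n N (Y.σ^[k] y) ∂m.toMeasure = ∫ y, LE π n N y ∂m.toMeasure := by
    intro n N k
    have hk := (invP_mp hm).iterate k
    conv_rhs => rw [← hk.map_eq]
    rw [integral_map hk.measurable.aemeasurable (measurable_LE π n N).aestronglyMeasurable]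
  induction k with
  | zero => simp
  | succ k ih =>
    have h2 : ∫ y, LE π ((k + 1) * n + N) ((k + 1) * n + N) y ∂m.toMeasure ≤
        ∫ y, (LE π n N y + LE π (k * n + N) (k * n + N) (Y.σ^[n] y)) ∂m.toMeasure := by
      refine integral_mono (hi _ _) ((hi _ _).add
        (((invP_mp hm).iterate n).integrable_comp_of_integrable (hi _ _))) (fun y => ?_)
      have := LE_sub π n (k * n + N) N (k * n + N) (n + (k * n + N)) (by nlinarith) le_rfl y
      rw [show (k + 1) * n + N = n + (k * n + N) by ring]
      exact this
    have hci : Integrable (fun y => LE π (k * n + N) (k * n + N) (Y.σ^[n] y)) m.toMeasure :=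
      ((invP_mp hm).iterate n).integrable_comp_of_integrable (hi _ _)
    rw [integral_add (hi _ _) hci, hinv] at h2
    push_cast
    linarith

lemma le_relP (π : Factor X Y) (m : ProbabilityMeasure Y.pt) (hm : m ∈ invP Y) (c : ℝ)
    (hc : ∀ n : ℕ, 0 < n → n * c ≤ ∫ y, LE π n n y ∂m.toMeasure) :
    c ≤ ∫ y, relP π y ∂m.toMeasure := by
  set C := Real.log (Fintype.card A) with hCdef
  have h1 := fun n N k => LE_block π m hm n N k
  have h2 : ∀ n N : ℕ, 0 < n → n * c ≤ ∫ y, LE π n N y ∂m.toMeasure := by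
    intro n N hn
    by_contra hcon
    push Not at hcon
    set d := n * c - ∫ y, LE π n N y ∂m.toMeasure with hd
    have hd0 : 0 < d := by linarith
    obtain ⟨k, hk⟩ := exists_nat_gt ((∫ y, LE π N N y ∂m.toMeasure - N * c) / d)
    rw [div_lt_iff₀ hd0] at hk
    have h3 := h1 n N (k + 1)
    have h4 := hc ((k + 1) * n + N) (by positivity)
    push_cast at h3 h4
    nlinarith
  have h3 : ∀ n : ℕ, 0 < n → n * c ≤ ∫ y, Real.log (Dcnt π n y) ∂m.toMeasure := by
    intro n hn
    have : Tendsto (fun N => ∫ y, LE π n N y ∂m.toMeasure) atTop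
        (𝓝 (∫ y, Real.log (Dcnt π n y) ∂m.toMeasure)) := by
      refine tendsto_integral_of_dominated_convergence (fun _ => n * C)
        (fun N => (measurable_LE π n N).aestronglyMeasurable) (integrable_const _)
        (fun N => ae_of_all _ (LE_abs π n N)) (ae_of_all _ (logD_tendsto π n))
    exact ge_of_tendsto' this (fun N => h2 n N hn)
  refine aux_revFatou m.toMeasure (fun n y => Real.log (Dcnt π n y) / n)
    (fun n => (logD_measurable π n).div_const _) C (fun n y => (logD_bound π n y).1)
    (fun n y => (logD_bound π n y).2) c ?_
  filter_upwards [eventually_gt_atTop 0] with n hn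
  rw [integral_div, le_div_iff₀ (by exact_mod_cast hn), mul_comm]
  exact h3 n hn

end Words


section Ent

lemma aux_fib {Ω S : Type*} [MeasurableSpace Ω] [Fintype S] [MeasurableSpace S]
    [MeasurableSingletonClass S] (ν : Measure Ω) [IsFiniteMeasure ν] {f : Ω → S}
    (hf : Measurable f) (P : S → Prop) [DecidablePred P] :
    ∑ s with P s, ν.real (f ⁻¹' {s}) = ν.real {x | P (f x)} := by
  rw [sum_measureReal_preimage_singleton _ (fun y _ => hf (measurableSet_singleton y))]
  congr 1
  ext x
  simp

lemma aux_fib_univ {Ω S : Type*} [MeasurableSpace Ω] [Fintype S] [MeasurableSpace S]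
    [MeasurableSingletonClass S] (ν : Measure Ω) [IsFiniteMeasure ν] {f : Ω → S}
    (hf : Measurable f) : ∑ s, ν.real (f ⁻¹' {s}) = ν.real univ := by
  have := aux_fib ν hf (fun _ => True)
  simpa using this

lemma aux_marg {Ω S : Type*} [MeasurableSpace Ω] [Fintype S] [MeasurableSpace S]
    [MeasurableSingletonClass S] (ν : Measure Ω) [IsFiniteMeasure ν] {f : Ω → S}
    (hf : Measurable f) (E : Set Ω) (hE : MeasurableSet E) :
    ∑ s, ν.real (E ∩ f ⁻¹' {s}) = ν.real E := by
  have := aux_fib_univ (ν.restrict E) hf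
  simp only [measureReal_restrict_apply (hf (measurableSet_singleton _))] at this
  rw [measureReal_restrict_apply MeasurableSet.univ, univ_inter] at this
  rw [← this]
  simp only [inter_comm]

/-- Entropy of a finite-valued map. -/
noncomputable def HH {Ω S : Type*} [MeasurableSpace Ω] [Fintype S] (ν : Measure Ω)
    (f : Ω → S) : ℝ := ∑ s, Real.negMulLog (ν.real (f ⁻¹' {s}))

lemma HH_nonneg {Ω S : Type*} [MeasurableSpace Ω] [Fintype S] (ν : Measure Ω)
    [IsProbabilityMeasure ν] (f : Ω → S) : 0 ≤ HH ν f :=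
  Finset.sum_nonneg (fun s _ => Real.negMulLog_nonneg measureReal_nonneg measureReal_le_one)

lemma HH_le {Ω S : Type*} [MeasurableSpace Ω] [Fintype S] [MeasurableSpace S]
    [MeasurableSingletonClass S] (ν : Measure Ω)
    [IsProbabilityMeasure ν] {f : Ω → S} (hf : Measurable f) :
    HH ν f ≤ Real.log (Fintype.card S) := by
  have := aux_H_one Finset.univ (fun s => ν.real (f ⁻¹' {s})) (fun s => measureReal_nonneg)
  rw [aux_fib_univ ν hf] at this
  simpa [HH] using this

lemma HH_pair {Ω S T : Type*} [MeasurableSpace Ω] [Fintype S] [MeasurableSpace S]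
    [MeasurableSingletonClass S] [Fintype T] [MeasurableSpace T]
    [MeasurableSingletonClass T] (ν : Measure Ω)
    [IsProbabilityMeasure ν] {f : Ω → S} (hf : Measurable f) {g : Ω → T} (hg : Measurable g) :
    ∑ s, ∑ t, Real.negMulLog (ν.real (f ⁻¹' {s} ∩ g ⁻¹' {t})) ≤ HH ν f + HH ν g := by
  have h1 : ∀ s, ∑ t, ν.real (f ⁻¹' {s} ∩ g ⁻¹' {t}) = ν.real (f ⁻¹' {s}) := fun s =>
    aux_marg ν hg _ (hf (measurableSet_singleton s))
  have h2 : ∀ t, ∑ s, ν.real (f ⁻¹' {s} ∩ g ⁻¹' {t}) = ν.real (g ⁻¹' {t}) := fun t => by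
    simp only [inter_comm (f ⁻¹' _)]
    exact aux_marg ν hf _ (hg (measurableSet_singleton t))
  have := aux_H_sub (fun s t => ν.real (f ⁻¹' {s} ∩ g ⁻¹' {t})) (fun s t => measureReal_nonneg)
    (by simp only [h1]; rw [aux_fib_univ ν hf]; simp)
  simpa only [HH, h1, h2] using this

variable {A B : Type*}
  [Fintype A] [TopologicalSpace A] [DiscreteTopology A]
  [MeasurableSpace A] [MeasurableSingletonClass A]
  [Fintype B] [TopologicalSpace B] [DiscreteTopology B]
  [MeasurableSpace B] [MeasurableSingletonClass B]

/-- Entropy of the word of length `n` at position `i`. -/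
noncomputable def hI (X : Subshift A) (ν : Measure X.pt) (i n : ℕ) : ℝ :=
  HH ν (fun x => wd X n (X.σ^[i] x))

lemma measurable_wdi (X : Subshift A) (i n : ℕ) : Measurable (fun x => wd X n (X.σ^[i] x)) :=
  (measurable_wd X n).comp ((measurable_sigma X).iterate i)

lemma cyl_eq (X : Subshift A) {n : ℕ} (w : Fin n → A) : cyl X w = wd X n ⁻¹' {w} := by
  ext x
  exact ⟨fun h => funext h, fun h i => congrFun h i⟩

lemma blockH_eq (X : Subshift A) (μ : ProbabilityMeasure X.pt) (n : ℕ) :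
    blockH X μ n = hI X μ.toMeasure 0 n := by
  unfold blockH hI HH
  simp only [cyl_eq]
  rfl

lemma hI_nonneg (X : Subshift A) (ν : Measure X.pt) [IsProbabilityMeasure ν] (i n : ℕ) :
    0 ≤ hI X ν i n := HH_nonneg _ _

lemma hI_le (X : Subshift A) (ν : Measure X.pt) [IsProbabilityMeasure ν] (i n : ℕ) :
    hI X ν i n ≤ n * Real.log (Fintype.card A) := by
  refine (HH_le ν (measurable_wdi X i n)).trans (le_of_eq ?_)
  rw [← Real.log_pow]
  simp

lemma hI_sub (X : Subshift A) (ν : Measure X.pt) [IsProbabilityMeasure ν] (i n k : ℕ) :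
    hI X ν i (n + k) ≤ hI X ν i n + hI X ν (i + n) k := by
  refine le_trans (le_of_eq ?_) (HH_pair ν (measurable_wdi X i n) (measurable_wdi X (i + n) k))
  unfold hI HH
  rw [← (Fin.appendEquiv n k).sum_comp, Fintype.sum_prod_type]
  refine Finset.sum_congr rfl (fun u _ => Finset.sum_congr rfl (fun v _ => ?_))
  congr 2
  ext x
  simp only [mem_preimage, mem_singleton_iff, mem_inter_iff]
  constructor
  · intro h
    constructor
    · funext j
      have := congrFun h (Fin.castAdd k j)
      simpa [wd, Fin.appendEquiv] using this
    · funext j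
      have := congrFun h (Fin.natAdd n j)
      simp only [wd, sigma_iter, Fin.appendEquiv, Equiv.coe_fn_mk, Fin.append_right,
        Fin.val_natAdd] at this ⊢
      rw [← this, add_assoc]
  · rintro ⟨rfl, rfl⟩
    funext j
    refine Fin.addCases (fun j => ?_) (fun j => ?_) j
    · simp [wd, Fin.appendEquiv]
    · simp only [wd, sigma_iter, Fin.appendEquiv, Equiv.coe_fn_mk, Fin.append_right,
        Fin.val_natAdd, add_assoc]

lemma hI_inv (X : Subshift A) (μ : ProbabilityMeasure X.pt) (hμ : μ ∈ invP X) (i n : ℕ) :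
    hI X μ.toMeasure i n = hI X μ.toMeasure 0 n := by
  unfold hI HH
  refine Finset.sum_congr rfl (fun w _ => ?_)
  congr 1
  have h := ((invP_mp hμ).iterate i).measureReal_preimage
    ((measurable_wd X n) (measurableSet_singleton w)).nullMeasurableSet
  exact h

lemma KS_le (X : Subshift A) (μ : ProbabilityMeasure X.pt) (n : ℕ) (hn : 0 < n) :
    n * KS X μ ≤ hI X μ.toMeasure 0 n := by
  have hb : BddBelow (range fun n : ℕ => blockH X μ (n + 1) / (n + 1)) := by
    refine ⟨0, ?_⟩
    rintro _ ⟨k, rfl⟩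
    change 0 ≤ blockH X μ (k + 1) / ((k : ℝ) + 1)
    rw [blockH_eq]
    exact div_nonneg (hI_nonneg _ _ _ _) (by positivity)
  have h : KS X μ ≤ blockH X μ (n - 1 + 1) / (((n - 1 : ℕ) : ℝ) + 1) := ciInf_le hb (n - 1)
  have e : n - 1 + 1 = n := by omega
  have e' : ((n - 1 : ℕ) : ℝ) + 1 = n := by exact_mod_cast e
  rw [e, e', blockH_eq, le_div_iff₀ (by exact_mod_cast hn)] at h
  rw [mul_comm]
  exact h

lemma le_KS (X : Subshift A) (μ : ProbabilityMeasure X.pt) (c : ℝ)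
    (h : ∀ n : ℕ, 0 < n → n * c ≤ hI X μ.toMeasure 0 n) : c ≤ KS X μ := by
  refine le_ciInf (fun n => ?_)
  rw [blockH_eq, le_div_iff₀ (by positivity), mul_comm]
  have := h (n + 1) (by omega)
  exact_mod_cast this

lemma KS_ev (X : Subshift A) (μ : ProbabilityMeasure X.pt) (hμ : μ ∈ invP X) (ε : ℝ)
    (hε : 0 < ε) : ∀ᶠ n : ℕ in atTop, hI X μ.toMeasure 0 n / n < KS X μ + ε := by
  have hs : Subadditive (hI X μ.toMeasure 0) := by
    intro n k
    have := hI_sub X μ.toMeasure 0 n k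
    rwa [zero_add, hI_inv X μ hμ n k] at this
  obtain ⟨n, hn⟩ := exists_lt_of_ciInf_lt (show KS X μ < KS X μ + ε by linarith)
  rw [blockH_eq] at hn
  exact hs.eventually_div_lt_of_div_lt (n := n + 1) (by omega) (by exact_mod_cast hn)

variable {X : Subshift A} {Y : Subshift B}

lemma integral_wd (Y : Subshift B) (m : Measure Y.pt) [IsProbabilityMeasure m] (n : ℕ)
    (h : (Fin n → B) → ℝ) :
    ∫ y, h (wd Y n y) ∂m = ∑ v, m.real (wd Y n ⁻¹' {v}) * h v := by
  have hp := Measure.isProbabilityMeasure_map (μ := m) (measurable_wd Y n).aemeasurable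
  rw [← integral_map (f := h) (measurable_wd Y n).aemeasurable
    (measurable_of_countable h).aestronglyMeasurable, integral_fintype (Integrable.of_finite)]
  refine Finset.sum_congr rfl (fun v _ => ?_)
  rw [map_measureReal_apply (measurable_wd Y n) (measurableSet_singleton v), smul_eq_mul]

lemma push_toMeasure (π : Factor X Y) (μ : ProbabilityMeasure X.pt) :
    (π.push μ).toMeasure = μ.toMeasure.map π.map := rfl

lemma push_inv (π : Factor X Y) (μ : ProbabilityMeasure X.pt) (hμ : μ ∈ invP X) :
    π.push μ ∈ invP Y := by
  have h : μ.toMeasure.map X.σ = μ.toMeasure := hμ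
  change (π.push μ).toMeasure.map Y.σ = (π.push μ).toMeasure
  rw [push_toMeasure, Measure.map_map (measurable_sigma Y) π.measurable_map]
  have : Y.σ ∘ π.map = π.map ∘ X.σ := rfl
  rw [this, ← Measure.map_map π.measurable_map (measurable_sigma X), h]

lemma wset_card (π : Factor X Y) {n : ℕ} (v : Fin n → B) :
    Nat.card {w : Fin n → A // allowW X w ∧ (fun i => π.symb (w i)) = v} =
      (wset π n v).ncard := by
  rw [← preCnt_eq, preCnt]
  simp only [funext_iff]

lemma hI_factor (π : Factor X Y) (μ : ProbabilityMeasure X.pt) (n : ℕ) :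
    hI X μ.toMeasure 0 n ≤ hI Y (π.push μ).toMeasure 0 n +
      ∫ y, LE π n n y ∂(π.push μ).toMeasure := by
  have h := aux_H_fiber (fun (w : Fin n → A) => fun i => π.symb (w i)) (fun w => allowW X w)
    (fun w => μ.toMeasure.real (wd X n ⁻¹' {w})) (fun w => measureReal_nonneg) (by
      intro w hw
      have : wd X n ⁻¹' {w} = ∅ := by
        ext x
        simp only [mem_preimage, mem_singleton_iff, mem_empty_iff_false, iff_false]
        rintro rfl
        exact hw ⟨x.1, x.2, fun i => rfl⟩
      rw [this]; simp)
  refine le_trans h (le_of_eq ?_)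
  have e : ∀ v : Fin n → B, ∑ w with (fun i => π.symb (w i)) = v,
      μ.toMeasure.real (wd X n ⁻¹' {w}) = (π.push μ).toMeasure.real (wd Y n ⁻¹' {v}) := by
    intro v
    rw [aux_fib μ.toMeasure (measurable_wd X n) (fun w => (fun i => π.symb (w i)) = v),
      push_toMeasure, map_measureReal_apply π.measurable_map
        (measurable_wd Y n (measurableSet_singleton v))]
    rfl
  have e2 : ∫ y, LE π n n y ∂(π.push μ).toMeasure = _ :=
    integral_wd Y (π.push μ).toMeasure n (fun v => Real.log ((wset π n v).ncard))
  rw [e2, hI, HH, ← Finset.sum_add_distrib]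
  refine Finset.sum_congr rfl (fun v _ => ?_)
  rw [e, wset_card]
  rfl

lemma KS_upper (π : Factor X Y) (μ : ProbabilityMeasure X.pt) (hμ : μ ∈ invP X) :
    KS X μ ≤ KS Y (π.push μ) + ∫ y, relP π y ∂(π.push μ).toMeasure := by
  have hm := push_inv π μ hμ
  have : KS X μ - KS Y (π.push μ) ≤ ∫ y, relP π y ∂(π.push μ).toMeasure := by
    refine le_relP π _ hm _ (fun n hn => ?_)
    have hn' : (0:ℝ) < n := by exact_mod_cast hn
    refine le_of_forall_pos_le_add (fun ε hε => ?_)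
    obtain ⟨K, hK⟩ := eventually_atTop.1 (KS_ev Y (π.push μ) hm (ε / n) (by positivity))
    have hN : K ≤ K * n + n := by nlinarith
    have hN0 : 0 < K * n + n := by positivity
    have h1 := hK _ hN
    rw [div_lt_iff₀ (by exact_mod_cast hN0)] at h1
    have h2 := KS_le X μ _ hN0
    have h3 := hI_factor π μ (K * n + n)
    have h4 := LE_block π _ hm n n K
    push_cast at h1 h2
    have h5 : ((K:ℝ) + 1) * (n * (KS X μ - KS Y (π.push μ))) ≤
        (K + 1) * (∫ y, LE π n n y ∂(π.push μ).toMeasure + ε) := by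
      have h6 : (KS Y (π.push μ) + ε / n) * (K * n + n) =
          KS Y (π.push μ) * (K * n + n) + (K + 1) * ε := by field_simp
      nlinarith
    exact le_of_mul_le_mul_left h5 (by positivity)
  linarith

end Ent


section Exist

variable {A B : Type*}
  [Fintype A] [TopologicalSpace A] [DiscreteTopology A]
  [MeasurableSpace A] [MeasurableSingletonClass A]
  [Fintype B] [TopologicalSpace B] [DiscreteTopology B]
  [MeasurableSpace B] [MeasurableSingletonClass B]

lemma continuous_real_clopen (X : Subshift A) {S : Set X.pt} (hS : IsClopen S) :
    Continuous (fun μ : ProbabilityMeasure X.pt => μ.toMeasure.real S) := by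
  let f : BoundedContinuousFunction X.pt ℝ :=
    BoundedContinuousFunction.mkOfCompact ⟨S.indicator 1, (IsClopen.continuous_indicator hS
      (f := (1 : X.pt → ℝ)) continuous_one)⟩
  have h := ProbabilityMeasure.continuous_integral_boundedContinuousFunction f
  convert h using 2 with μ
  change _ = ∫ x, S.indicator 1 x ∂μ.toMeasure
  rw [integral_indicator_one hS.isOpen.measurableSet]

lemma clopen_wd (X : Subshift A) (n : ℕ) (T : Set (Fin n → A)) : IsClopen (wd X n ⁻¹' T) :=
  (isClopen_discrete T).preimage (continuous_wd X n)

lemma continuous_hI (X : Subshift A) (n : ℕ) :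
    Continuous (fun μ : ProbabilityMeasure X.pt => hI X μ.toMeasure 0 n) := by
  unfold hI HH
  refine continuous_finsetSum _ (fun w _ => Real.continuous_negMulLog.comp ?_)
  exact continuous_real_clopen X (clopen_wd X n {w})

lemma aux_ext (X : Subshift A) (μ ν : Measure X.pt) [IsProbabilityMeasure μ]
    [IsProbabilityMeasure ν]
    (h : ∀ n (w : Fin n → A), μ.real (wd X n ⁻¹' {w}) = ν.real (wd X n ⁻¹' {w})) : μ = ν := by
  refine ext_of_generate_finite {S | ∃ n, ∃ T : Set (Fin n → A), S = wd X n ⁻¹' T} ?_ ?_ ?_ ?_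
  · apply le_antisymm
    · apply measurable_iff_comap_le.1
      refine @measurable_pi_lambda _ _ _ (_) _ _ (fun i => ?_)
      refine @measurable_to_countable' _ _ _ _ (_) _ (fun a => ?_)
      apply MeasurableSpace.measurableSet_generateFrom
      refine ⟨i + 1, {w | w (Fin.last i) = a}, ?_⟩
      ext x
      simp [wd]
    · refine MeasurableSpace.generateFrom_le ?_
      rintro _ ⟨n, T, rfl⟩
      exact measurable_wd X n (Set.toFinite T).measurableSet
  · rintro _ ⟨n, T, rfl⟩ _ ⟨k, T', rfl⟩ _
    refine ⟨n + k, {w | (fun i : Fin n => w (Fin.castLE (by omega) i)) ∈ T ∧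
      (fun i : Fin k => w (Fin.castLE (by omega) i)) ∈ T'}, ?_⟩
    ext x
    simp [wd]
    rfl
  · rintro _ ⟨n, T, rfl⟩
    have h1 := aux_fib μ (measurable_wd X n) (fun w => w ∈ T)
    have h2 := aux_fib ν (measurable_wd X n) (fun w => w ∈ T)
    simp only [h] at h1
    have h3 : μ.real (wd X n ⁻¹' T) = ν.real (wd X n ⁻¹' T) := h1.symm.trans h2
    exact (measureReal_eq_measureReal_iff).1 h3
  · simp

variable {X : Subshift A} {Y : Subshift B}

lemma exists_nu (π : Factor X Y) (m : Measure Y.pt) [IsProbabilityMeasure m] (n : ℕ) :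
    ∃ ν : Measure X.pt, IsProbabilityMeasure ν ∧
      (∀ v, ν.real {x | wd Y n (π.map x) = v} = m.real (wd Y n ⁻¹' {v})) ∧
      hI X ν 0 n = hI Y m 0 n + ∫ y, LE π n n y ∂m := by
  have hne : Nonempty X.pt := by
    have : Nonempty Y.pt := nonempty_of_isProbabilityMeasure m
    obtain ⟨y⟩ := this
    obtain ⟨x, -⟩ := π.map_surj y
    exact ⟨x⟩
  let s : (Fin n → A) → (Fin n → B) := fun w i => π.symb (w i)
  let M : (Fin n → B) → ℝ := fun v => m.real (wd Y n ⁻¹' {v})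
  let p : (Fin n → A) → ℝ := fun w =>
    if w ∈ wset π n (s w) then M (s w) / (wset π n (s w)).ncard else 0
  have hp0 : ∀ w, 0 ≤ p w := by
    intro w
    simp only [p]
    split_ifs
    · exact div_nonneg measureReal_nonneg (by positivity)
    · exact le_rfl
  have hM0 : ∀ v, wset π n v = ∅ → M v = 0 := by
    intro v hv
    have : wd Y n ⁻¹' {v} = ∅ := by
      ext y
      simp only [mem_preimage, mem_singleton_iff, mem_empty_iff_false, iff_false]
      rintro rfl
      exact (wset_nonempty π n n y).ne_empty hv
    simp [M, this]
  have hsum : ∀ (h : ℝ → ℝ), h 0 = 0 → ∀ v, ∑ w with s w = v, h (p w) =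
      (wset π n v).ncard * h (M v / (wset π n v).ncard) := by
    intro h h0 v
    have hs : ∀ w ∈ wset π n v, s w = v := by
      rintro w ⟨x, rfl, rfl⟩; rfl
    have e : ∀ w, (if s w = v then h (p w) else 0) =
        if w ∈ wset π n v then h (M v / (wset π n v).ncard) else 0 := by
      intro w
      by_cases h1 : s w = v
      · by_cases h2 : w ∈ wset π n v
        · simp [p, h1, h2]
        · simp [p, h1, h2, h0]
      · have h2 : w ∉ wset π n v := fun hw => h1 (hs w hw)
        simp [h1, h2]
    rw [Finset.sum_filter]
    simp only [e]
    rw [← Finset.sum_filter, Finset.sum_const, nsmul_eq_mul]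
    congr 2
    rw [Set.ncard_eq_toFinset_card']
    congr 1
    ext w
    simp
  have hsum1 : ∀ v, ∑ w with s w = v, p w = M v := by
    intro v
    refine (hsum id rfl v).trans ?_
    rcases eq_or_ne (wset π n v) ∅ with h | h
    · simp [hM0 v h]
    · have : (0:ℝ) < (wset π n v).ncard := by
        exact_mod_cast (Set.ncard_pos (Set.toFinite _)).2 (nonempty_iff_ne_empty.2 h)
      simp only [id]
      field_simp
  have hg : ∀ w, ∃ x : X.pt, w ∈ wset π n (s w) → wd X n x = w := by
    intro w
    by_cases h : w ∈ wset π n (s w)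
    · obtain ⟨x, hx, -⟩ := h
      exact ⟨x, fun _ => hx⟩
    · exact ⟨hne.some, fun h' => absurd h' h⟩
  choose g hg using hg
  let ν : Measure X.pt := ∑ w, ENNReal.ofReal (p w) • Measure.dirac (g w)
  have hM1 : ∑ v, M v = 1 := by
    simp only [M]
    rw [aux_fib_univ m (measurable_wd Y n)]; simp
  have hp1 : ∑ w, p w = 1 := by
    rw [← Finset.sum_fiberwise Finset.univ s]
    simp only [hsum1, hM1]
  have hν : IsProbabilityMeasure ν := by
    constructor
    simp only [ν, Measure.coe_finsetSum, Finset.sum_apply, Measure.smul_apply, measure_univ,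
      smul_eq_mul, mul_one]
    rw [← ENNReal.ofReal_sum_of_nonneg (fun w _ => hp0 w), hp1]; simp
  have hνw : ∀ u, ν.real (wd X n ⁻¹' {u}) = p u := by
    intro u
    have hm : MeasurableSet (wd X n ⁻¹' {u}) := measurable_wd X n (measurableSet_singleton u)
    have : ν (wd X n ⁻¹' {u}) = ENNReal.ofReal (p u) := by
      simp only [ν, Measure.coe_finsetSum, Finset.sum_apply, Measure.smul_apply, smul_eq_mul,
        Measure.dirac_apply' _ hm]
      rw [Finset.sum_eq_single u]
      · by_cases h : u ∈ wset π n (s u)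
        · simp [indicator, hg u h]
        · simp [p, h]
      · intro w _ hwu
        by_cases h : w ∈ wset π n (s w)
        · simp [indicator, hg w h, hwu]
        · simp [p, h]
      · simp
    rw [Measure.real, this, ENNReal.toReal_ofReal (hp0 u)]
  refine ⟨ν, hν, fun v => ?_, ?_⟩
  · have := aux_fib ν (measurable_wd X n) (fun w => s w = v)
    simp only [hνw, hsum1] at this
    exact this.symm
  · have e2 : ∫ y, LE π n n y ∂m = _ :=
      integral_wd Y m n (fun v => Real.log ((wset π n v).ncard))
    have e1 : hI X ν 0 n = ∑ w, Real.negMulLog (p w) :=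
      Finset.sum_congr rfl (fun w _ => congrArg Real.negMulLog (hνw w))
    rw [e2, e1, hI, HH, ← Finset.sum_add_distrib, ← Finset.sum_fiberwise Finset.univ s]
    refine Finset.sum_congr rfl (fun v _ => ?_)
    rw [hsum Real.negMulLog Real.negMulLog_zero v]
    change _ = Real.negMulLog (M v) + M v * _
    rcases eq_or_ne (wset π n v) ∅ with h | h
    · simp [hM0 v h]
    · have hc : (0:ℝ) < (wset π n v).ncard := by
        exact_mod_cast (Set.ncard_pos (Set.toFinite _)).2 (nonempty_iff_ne_empty.2 h)
      rcases eq_or_ne (M v) 0 with h0 | h0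
      · simp [h0]
      · rw [Real.negMulLog, Real.negMulLog, Real.log_div h0 hc.ne']
        field_simp
        ring

lemma exists_mun (π : Factor X Y) (m : ProbabilityMeasure Y.pt) (hm : m ∈ invP Y) (n : ℕ)
    (hn : 0 < n) : ∃ μ : ProbabilityMeasure X.pt,
      (∀ S, MeasurableSet S → |μ.toMeasure.real (X.σ ⁻¹' S) - μ.toMeasure.real S| ≤ 1 / n) ∧
      (∀ L (v : Fin L → B), |μ.toMeasure.real (π.map ⁻¹' (wd Y L ⁻¹' {v})) -
        m.toMeasure.real (wd Y L ⁻¹' {v})| ≤ L / n) ∧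
      (∀ q : ℕ, q * (KS Y m + ∫ y, relP π y ∂m.toMeasure) ≤
        hI X μ.toMeasure 0 q + 2 * q ^ 2 * Real.log (Fintype.card A) / n) := by
  obtain ⟨ν, hν, hlaw, hent⟩ := exists_nu π m.toMeasure n
  have hn' : (0:ℝ) < n := by exact_mod_cast hn
  let μ : Measure X.pt := (n : ℝ≥0∞)⁻¹ • ∑ i ∈ Finset.range n, ν.map (X.σ^[i])
  have hpm : ∀ i, IsProbabilityMeasure (ν.map (X.σ^[i])) := fun i =>
    Measure.isProbabilityMeasure_map ((measurable_sigma X).iterate i).aemeasurable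
  have hμ : IsProbabilityMeasure μ := by
    constructor
    simp only [μ, Measure.smul_apply, Measure.coe_finsetSum, Finset.sum_apply, measure_univ,
      smul_eq_mul, Finset.sum_const, Finset.card_range, nsmul_eq_mul, mul_one]
    exact ENNReal.inv_mul_cancel (by exact_mod_cast hn.ne') (ENNReal.natCast_ne_top n)
  have hreal : ∀ S, MeasurableSet S →
      μ.real S = (∑ i ∈ Finset.range n, ν.real (X.σ^[i] ⁻¹' S)) / n := by
    intro S hS
    simp only [Measure.real, μ, Measure.smul_apply, Measure.coe_finsetSum, Finset.sum_apply,
      smul_eq_mul, ENNReal.toReal_mul, ENNReal.toReal_inv, ENNReal.toReal_natCast]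
    rw [ENNReal.toReal_sum (fun i _ => measure_ne_top _ _), div_eq_inv_mul]
    congr 1
    refine Finset.sum_congr rfl (fun i _ => ?_)
    rw [Measure.map_apply ((measurable_sigma X).iterate i) hS]
  refine ⟨⟨μ, hμ⟩, ?_, ?_, ?_⟩
  · intro S hS
    change |μ.real (X.σ ⁻¹' S) - μ.real S| ≤ _
    rw [hreal S hS, hreal _ (measurable_sigma X hS), ← sub_div, ← Finset.sum_sub_distrib,
      abs_div, abs_of_pos hn']
    gcongr
    have : ∀ i, X.σ^[i] ⁻¹' (X.σ ⁻¹' S) = X.σ^[i + 1] ⁻¹' S := by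
      intro i
      rw [Function.iterate_succ', preimage_comp]
    simp only [this]
    rw [Finset.sum_range_sub (fun i => ν.real (X.σ^[i] ⁻¹' S))]
    have a1 : 0 ≤ ν.real (X.σ^[n] ⁻¹' S) := measureReal_nonneg
    have a2 : ν.real (X.σ^[n] ⁻¹' S) ≤ 1 := measureReal_le_one
    have a3 : 0 ≤ ν.real (X.σ^[0] ⁻¹' S) := measureReal_nonneg
    have a4 : ν.real (X.σ^[0] ⁻¹' S) ≤ 1 := measureReal_le_one
    rw [abs_le]; constructor <;> linarith
  · intro L v
    change |μ.real _ - _| ≤ _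
    have hmv : MeasurableSet (wd Y L ⁻¹' {v}) := measurable_wd Y L (measurableSet_singleton v)
    rw [hreal _ (π.measurable_map hmv)]
    set c := m.toMeasure.real (wd Y L ⁻¹' {v}) with hc
    have hc0 : 0 ≤ c := measureReal_nonneg
    have hc1 : c ≤ 1 := measureReal_le_one
    have e1 : c = (∑ i ∈ Finset.range n, c) / n := by
      rw [Finset.sum_const, Finset.card_range, nsmul_eq_mul]; field_simp
    rw [e1, ← sub_div, ← Finset.sum_sub_distrib, abs_div, abs_of_pos hn']
    gcongr
    have key : ∀ i, i + L ≤ n →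
        ν.real (X.σ^[i] ⁻¹' (π.map ⁻¹' (wd Y L ⁻¹' {v}))) = c := by
      intro i hi
      let P : (Fin n → B) → Prop := fun u => ∀ j : Fin L, u ⟨i + j, by omega⟩ = v j
      have f1 := aux_fib ν (((measurable_wd Y n).comp π.measurable_map)) P
      have f2 := aux_fib m.toMeasure (measurable_wd Y n) P
      have f3 : ∀ u, ν.real ((wd Y n ∘ π.map) ⁻¹' {u}) = m.toMeasure.real (wd Y n ⁻¹' {u}) :=
        fun u => hlaw u
      simp only [f3] at f1
      rw [f1] at f2
      have g1 : {x | P ((wd Y n ∘ π.map) x)} = X.σ^[i] ⁻¹' (π.map ⁻¹' (wd Y L ⁻¹' {v})) := by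
        ext x
        change (∀ j : Fin L, (π.map x).1 (i + j) = v j) ↔ wd Y L (π.map (X.σ^[i] x)) = v
        rw [π.map_sigma_iter, funext_iff]
        simp only [wd, sigma_iter]
      have g2 : {y | P (wd Y n y)} = Y.σ^[i] ⁻¹' (wd Y L ⁻¹' {v}) := by
        ext x
        change (∀ j : Fin L, x.1 (i + j) = v j) ↔ wd Y L (Y.σ^[i] x) = v
        rw [funext_iff]
        simp only [wd, sigma_iter]
      rw [g1, g2] at f2
      rw [f2]
      exact ((invP_mp hm).iterate i).measureReal_preimage hmv.nullMeasurableSet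
    refine (Finset.abs_sum_le_sum_abs _ _).trans ?_
    have hb : ∀ i ∈ Finset.range n,
        |ν.real (X.σ^[i] ⁻¹' (π.map ⁻¹' (wd Y L ⁻¹' {v}))) - c| ≤
          if n < i + L then (1:ℝ) else 0 := by
      intro i _
      split_ifs with h
      · have a1 : 0 ≤ ν.real (X.σ^[i] ⁻¹' (π.map ⁻¹' (wd Y L ⁻¹' {v}))) := measureReal_nonneg
        have a2 : ν.real (X.σ^[i] ⁻¹' (π.map ⁻¹' (wd Y L ⁻¹' {v}))) ≤ 1 := measureReal_le_one
        rw [abs_le]; constructor <;> linarith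
      · rw [key i (by omega)]; simp
    refine (Finset.sum_le_sum hb).trans ?_
    rw [← Finset.sum_filter, Finset.sum_const, nsmul_eq_mul, mul_one]
    have : (Finset.range n).filter (fun i => n < i + L) ⊆ Finset.Ico (n - L) n := by
      intro i hi
      simp only [Finset.mem_filter, Finset.mem_range, Finset.mem_Ico] at hi ⊢
      omega
    have h2 := Finset.card_le_card this
    rw [Nat.card_Ico] at h2
    exact_mod_cast h2.trans (by omega)
  · intro q
    change _ ≤ hI X μ 0 q + _
    have hw := aux_window (fun i k => hI X ν i k) (Real.log (Fintype.card A))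
      (Real.log_natCast_nonneg _) (fun i a b => hI_sub X ν i a b) (fun i a => hI_nonneg X ν i a)
      (fun i a => hI_le X ν i a) q n
    have hJ : (∑ i ∈ Finset.range n, hI X ν i q) / n ≤ hI X μ 0 q := by
      have e1 : hI X μ 0 q = ∑ w, Real.negMulLog
          ((∑ i ∈ Finset.range n, ν.real (X.σ^[i] ⁻¹' (wd X q ⁻¹' {w}))) / n) := by
        refine Finset.sum_congr rfl (fun w _ => congrArg Real.negMulLog ?_)
        exact hreal _ (measurable_wd X q (measurableSet_singleton w))
      have e2 : ∑ i ∈ Finset.range n, hI X ν i q = ∑ w, ∑ i ∈ Finset.range n,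
          Real.negMulLog (ν.real (X.σ^[i] ⁻¹' (wd X q ⁻¹' {w}))) := by
        rw [Finset.sum_comm]; rfl
      rw [e1, e2, Finset.sum_div]
      refine Finset.sum_le_sum (fun w _ => ?_)
      have := Real.concaveOn_negMulLog.le_map_sum (t := Finset.range n)
        (w := fun _ => (1:ℝ) / n) (p := fun i => ν.real (X.σ^[i] ⁻¹' (wd X q ⁻¹' {w})))
        (fun i _ => by positivity)
        (by rw [Finset.sum_const, Finset.card_range, nsmul_eq_mul]; field_simp)
        (fun i _ => mem_Ici.2 measureReal_nonneg)
      simp only [smul_eq_mul, ← Finset.mul_sum] at this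
      rw [div_eq_inv_mul, div_eq_inv_mul, ← one_div]
      exact this
    have h1 := KS_le Y m n hn
    have h2 := relP_le π m hm n hn
    rw [div_le_iff₀ hn'] at hJ
    have h3 : (q : ℝ) * (n * (KS Y m + ∫ y, relP π y ∂m.toMeasure)) ≤ q * hI X ν 0 n := by
      refine mul_le_mul_of_nonneg_left ?_ (by positivity)
      rw [hent]; linarith
    rw [← sub_le_iff_le_add', le_div_iff₀ hn'] 
    nlinarith

lemma exists_lift (π : Factor X Y) (m : ProbabilityMeasure Y.pt) (hm : m ∈ invP Y) :
    ∃ μ ∈ invP X, π.push μ = m ∧ KS Y m + ∫ y, relP π y ∂m.toMeasure ≤ KS X μ := by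
  choose u hu1 hu2 hu3 using fun n : ℕ => exists_mun π m hm (n + 1) (Nat.succ_pos n)
  obtain ⟨μ, -, hμ⟩ := isCompact_univ.ultrafilter_le_nhds' ((hyperfilter ℕ).map u) univ_mem
  have hT : Tendsto u (hyperfilter ℕ : Filter ℕ) (𝓝 μ) := hμ
  have hz : ∀ c : ℝ, Tendsto (fun n : ℕ => c / ((n + 1 : ℕ) : ℝ)) (hyperfilter ℕ : Filter ℕ)
      (𝓝 0) := fun c =>
    (((tendsto_const_div_atTop_nhds_zero_nat c).comp (tendsto_add_atTop_nat 1))).mono_left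
      Nat.hyperfilter_le_atTop
  have hcl : ∀ S : Set X.pt, IsClopen S →
      Tendsto (fun n => (u n).toMeasure.real S) (hyperfilter ℕ : Filter ℕ)
        (𝓝 (μ.toMeasure.real S)) := fun S hS =>
    ((continuous_real_clopen X hS).tendsto μ).comp hT
  refine ⟨μ, ?_, ?_, ?_⟩
  · change μ.toMeasure.map X.σ = μ.toMeasure
    have := Measure.isProbabilityMeasure_map (μ := μ.toMeasure) (measurable_sigma X).aemeasurable
    refine aux_ext X _ _ (fun n w => ?_)
    have hc := clopen_wd X n {w}
    rw [map_measureReal_apply (measurable_sigma X) hc.isOpen.measurableSet]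
    have h1 := (hcl _ (hc.preimage (continuous_sigma X))).sub (hcl _ hc)
    have h2 : |μ.toMeasure.real (X.σ ⁻¹' (wd X n ⁻¹' {w})) - μ.toMeasure.real (wd X n ⁻¹' {w})|
        ≤ 0 := le_of_tendsto_of_tendsto' h1.abs (hz 1)
          (fun k => hu1 k _ hc.isOpen.measurableSet)
    exact sub_eq_zero.1 (abs_eq_zero.1 (le_antisymm h2 (abs_nonneg _)))
  · apply Subtype.ext
    change (π.push μ).toMeasure = m.toMeasure
    refine aux_ext Y _ _ (fun n w => ?_)
    have hc := clopen_wd Y n {w}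
    rw [push_toMeasure, map_measureReal_apply π.measurable_map hc.isOpen.measurableSet]
    have h1 := (hcl _ (hc.preimage π.continuous_map)).sub_const
      (m.toMeasure.real (wd Y n ⁻¹' {w}))
    have h2 : |μ.toMeasure.real (π.map ⁻¹' (wd Y n ⁻¹' {w})) - m.toMeasure.real (wd Y n ⁻¹' {w})|
        ≤ 0 := le_of_tendsto_of_tendsto' h1.abs (hz n) (fun k => hu2 k n w)
    exact sub_eq_zero.1 (abs_eq_zero.1 (le_antisymm h2 (abs_nonneg _)))
  · refine le_KS X μ _ (fun q _ => ?_)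
    have h1 := (((continuous_hI X q).tendsto μ).comp hT).add
      (hz (2 * q ^ 2 * Real.log (Fintype.card A)))
    rw [add_zero] at h1
    exact ge_of_tendsto' h1 (fun k => hu3 k q)

end Exist


section Final

variable {A B : Type*}
  [Fintype A] [TopologicalSpace A] [DiscreteTopology A]
  [MeasurableSpace A] [MeasurableSingletonClass A]
  [Fintype B] [TopologicalSpace B] [DiscreteTopology B]
  [MeasurableSpace B] [MeasurableSingletonClass B]
  {X : Subshift A} {Y : Subshift B}

lemma invP_closed (X : Subshift A) : IsClosed (invP X) := by
  have : invP X = ⋂ n, ⋂ w : Fin n → A, {μ : ProbabilityMeasure X.pt |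
      μ.toMeasure.real (X.σ ⁻¹' (wd X n ⁻¹' {w})) = μ.toMeasure.real (wd X n ⁻¹' {w})} := by
    ext μ
    simp only [mem_iInter]
    constructor
    · intro h n w
      exact (invP_mp h).measureReal_preimage
        (clopen_wd X n {w}).isOpen.measurableSet.nullMeasurableSet
    · intro h
      change μ.toMeasure.map X.σ = μ.toMeasure
      have := Measure.isProbabilityMeasure_map (μ := μ.toMeasure)
        (measurable_sigma X).aemeasurable
      refine aux_ext X _ _ (fun n w => ?_)
      rw [map_measureReal_apply (measurable_sigma X) (clopen_wd X n {w}).isOpen.measurableSet]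
      exact h n w
  rw [this]
  refine isClosed_iInter (fun n => isClosed_iInter (fun w => ?_))
  exact isClosed_eq
    (continuous_real_clopen X ((clopen_wd X n {w}).preimage (continuous_sigma X)))
    (continuous_real_clopen X (clopen_wd X n {w}))

lemma push_closed (π : Factor X Y) (m : ProbabilityMeasure Y.pt) :
    IsClosed {μ : ProbabilityMeasure X.pt | π.push μ = m} := by
  have : {μ : ProbabilityMeasure X.pt | π.push μ = m} = ⋂ n, ⋂ w : Fin n → B,
      {μ : ProbabilityMeasure X.pt | μ.toMeasure.real (π.map ⁻¹' (wd Y n ⁻¹' {w})) =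
        m.toMeasure.real (wd Y n ⁻¹' {w})} := by
    ext μ
    simp only [mem_iInter]
    constructor
    · intro h n w
      have h : π.push μ = m := h
      change μ.toMeasure.real (π.map ⁻¹' (wd Y n ⁻¹' {w})) = m.toMeasure.real (wd Y n ⁻¹' {w})
      rw [← h, push_toMeasure,
        map_measureReal_apply π.measurable_map (clopen_wd Y n {w}).isOpen.measurableSet]
    · intro h
      apply Subtype.ext
      change (π.push μ).toMeasure = m.toMeasure
      refine aux_ext Y _ _ (fun n w => ?_)
      rw [push_toMeasure,
        map_measureReal_apply π.measurable_map (clopen_wd Y n {w}).isOpen.measurableSet]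
      exact h n w
  rw [this]
  refine isClosed_iInter (fun n => isClosed_iInter (fun w => ?_))
  exact isClosed_eq
    (continuous_real_clopen X ((clopen_wd Y n {w}).preimage π.continuous_map)) continuous_const

lemma KS_closed (X : Subshift A) (c : ℝ) :
    IsClosed {μ : ProbabilityMeasure X.pt | c ≤ KS X μ} := by
  have : {μ : ProbabilityMeasure X.pt | c ≤ KS X μ} = ⋂ n : ℕ, ⋂ _ : 0 < n,
      {μ : ProbabilityMeasure X.pt | n * c ≤ hI X μ.toMeasure 0 n} := by
    ext μ
    simp only [mem_iInter]
    constructor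
    · intro h n hn
      exact (mul_le_mul_of_nonneg_left h (Nat.cast_nonneg n)).trans (KS_le X μ n hn)
    · intro h
      exact le_KS X μ c h
  rw [this]
  exact isClosed_iInter (fun n => isClosed_iInter (fun _ =>
    isClosed_le continuous_const (continuous_hI X n)))

lemma wt_eq (π : Factor X Y) (Φ : ℕ → Y.pt → ℝ) (hΦ : SubAdd Y Φ)
    (μ : ProbabilityMeasure X.pt) :
    wtFP X (fun x => -relP π (π.map x)) (fun n x => Φ n (π.map x)) μ =
      ((KS X μ - ∫ y, relP π y ∂(π.push μ).toMeasure : ℝ) : EReal) + potLim Y Φ (π.push μ) := by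
  unfold wtFP wtF potLim
  rw [push_toMeasure]
  congr 1
  · rw [integral_neg, integral_map π.measurable_map.aemeasurable
      (relP_measurable π).aestronglyMeasurable, ← EReal.coe_add, sub_eq_add_neg]
  · congr 1
    funext n
    rw [integral_map π.measurable_map.aemeasurable
      (hΦ.1 (n + 1) (Nat.succ_pos n)).measurable.aestronglyMeasurable]

end Final


/-- Proposition: if `M_Φ(Y, σ_Y)` consists of one point, then
`M_{-F∘π+Φ∘π}(X, σ_X)` is weak*-compact. -/
theorem statement6
    {A B : Type*}
    [Fintype A] [TopologicalSpace A] [DiscreteTopology A]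
    [MeasurableSpace A] [MeasurableSingletonClass A]
    [Fintype B] [TopologicalSpace B] [DiscreteTopology B]
    [MeasurableSpace B] [MeasurableSingletonClass B]
    (X : Subshift A) (Y : Subshift B) (π : Factor X Y)
    (Φ : ℕ → Y.pt → ℝ) (hΦ : SubAdd Y Φ)
    (hone : ∃ m : ProbabilityMeasure Y.pt, eqP Y Φ = {m}) :
    IsCompact (compEq π Φ) := by
  obtain ⟨m, hone⟩ := hone
  have hmem : m ∈ eqP Y Φ := by rw [hone]; exact mem_singleton m
  obtain ⟨hm, hS⟩ := hmem
  have hle : ∀ ν ∈ invP Y, wtP Y Φ ν ≤ wtP Y Φ m := by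
    intro ν hν
    rw [hS]
    exact le_sSup ⟨ν, hν, rfl⟩
  refine IsClosed.isCompact ?_
  by_cases hbot : potLim Y Φ m = ⊥
  · have hall : ∀ μ ∈ invP X,
        wtFP X (fun x => -relP π (π.map x)) (fun n x => Φ n (π.map x)) μ = ⊥ := by
      intro μ hμ
      have h1 := hle _ (push_inv π μ hμ)
      simp only [wtP, hbot, EReal.add_bot, le_bot_iff, EReal.add_eq_bot_iff, EReal.coe_ne_bot,
        false_or] at h1
      rw [wt_eq π Φ hΦ, h1, EReal.add_bot]
    have : compEq π Φ = invP X := by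
      ext μ
      constructor
      · exact fun h => h.1
      · intro h
        refine ⟨h, ?_⟩
        rw [hall μ h]
        symm
        rw [sSup_eq_bot]
        rintro _ ⟨ν, hν, rfl⟩
        exact hall ν hν
    rw [this]
    exact invP_closed X
  · have htop : potLim Y Φ m ≠ ⊤ := by
      refine ne_top_of_le_ne_top (EReal.coe_ne_top _) (iInf_le _ 0)
    obtain ⟨r, hr⟩ : ∃ r : ℝ, potLim Y Φ m = (r : EReal) :=
      ⟨_, (EReal.coe_toReal htop hbot).symm⟩
    have hwm : wtP Y Φ m = ((KS Y m + r : ℝ) : EReal) := by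
      rw [wtP, hr, EReal.coe_add]
    have hup : ∀ μ ∈ invP X,
        wtFP X (fun x => -relP π (π.map x)) (fun n x => Φ n (π.map x)) μ ≤
          wtP Y Φ (π.push μ) := by
      intro μ hμ
      rw [wt_eq π Φ hΦ, wtP]
      gcongr
      have := KS_upper π μ hμ
      exact_mod_cast (by linarith :
        KS X μ - ∫ y, relP π y ∂(π.push μ).toMeasure ≤ KS Y (π.push μ))
    have hval : ∀ μ, π.push μ = m →
        wtFP X (fun x => -relP π (π.map x)) (fun n x => Φ n (π.map x)) μ =
          ((KS X μ - ∫ y, relP π y ∂m.toMeasure + r : ℝ) : EReal) := by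
      intro μ h
      rw [wt_eq π Φ hΦ, h, hr, ← EReal.coe_add]
    have hlow : ∀ μ, π.push μ = m → KS Y m + ∫ y, relP π y ∂m.toMeasure ≤ KS X μ →
        wtP Y Φ m ≤ wtFP X (fun x => -relP π (π.map x)) (fun n x => Φ n (π.map x)) μ := by
      intro μ h h2
      rw [hval μ h, hwm]
      exact EReal.coe_le_coe_iff.2 (by linarith)
    have hsup : sSup (wtFP X (fun x => -relP π (π.map x)) (fun n x => Φ n (π.map x)) '' invP X) =
        wtP Y Φ m := by
      apply le_antisymm
      · refine sSup_le ?_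
        rintro _ ⟨μ, hμ, rfl⟩
        exact (hup μ hμ).trans (hle _ (push_inv π μ hμ))
      · obtain ⟨μ, hμ, h1, h2⟩ := exists_lift π m hm
        exact (hlow μ h1 h2).trans (le_sSup ⟨μ, hμ, rfl⟩)
    have : compEq π Φ = invP X ∩ ({μ | π.push μ = m} ∩
        {μ | KS Y m + ∫ y, relP π y ∂m.toMeasure ≤ KS X μ}) := by
      ext μ
      constructor
      · rintro ⟨hμ, h⟩
        rw [hsup] at h
        have hpm : π.push μ = m := by
          have : π.push μ ∈ eqP Y Φ := by
            refine ⟨push_inv π μ hμ, ?_⟩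
            rw [← hS]
            exact le_antisymm (hle _ (push_inv π μ hμ)) (h ▸ hup μ hμ)
          rw [hone] at this
          exact this
        refine ⟨hμ, hpm, ?_⟩
        rw [hval μ hpm, hwm, EReal.coe_eq_coe_iff] at h
        change _ ≤ KS X μ
        linarith
      · rintro ⟨hμ, hpm, h2⟩
        refine ⟨hμ, ?_⟩
        rw [hsup]
        exact le_antisymm ((hup μ hμ).trans (hle _ (push_inv π μ hμ))) (hlow μ hpm h2)
    rw [this]
    exact (invP_closed X).inter ((push_closed π m).inter (KS_closed X _))

end Paper
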